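/- arXiv:2302.12153 — 5 statements merged into one kernel-verified Lean document; each statement's English description precedes it below -/
import Mathlib

section
/- The chromatic polynomial is binomial: for every finite simple graph G and all natural numbers x, y, one has χ_G(x+y) = Σ_{U ⊆ V(G)} χ_{G|_U}(x) · χ_{G|_{V(G)∖U}}(y), the sum being over all subsets U of the vertex set (the chromatic polynomial of the empty graph equals 1). -/
/-- The number of proper colorings of the graph `G` in `c` colors. -/
noncomputable def chromVal {V : Type} (G : SimpleGraph V) (c : ℕ) : ℕ :=
  Nat.card {φ : V → Fin c // ∀ u v, G.Adj u v → φ u ≠ φ v}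

/-- Glue a coloring on `U` with `x` colors and a coloring on `Uᶜ` with `y` colors
into a coloring with `x + y` colors. -/
def glueColoring {V : Type} [Fintype V] [DecidableEq V] {x y : ℕ} (U : Finset V)
    (f : (↑U : Set V) → Fin x) (g : (↑(Uᶜ) : Set V) → Fin y) (v : V) : Fin (x + y) :=
  if h : v ∈ U then Fin.castAdd y (f ⟨v, h⟩)
  else Fin.natAdd x (g ⟨v, Finset.mem_coe.2 (Finset.mem_compl.2 h)⟩)

section glueColoring

variable {V : Type} [Fintype V] [DecidableEq V] {x y : ℕ} {U : Finset V}
  {f : (↑U : Set V) → Fin x} {g : (↑(Uᶜ) : Set V) → Fin y}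

theorem glueColoring_of_mem {v : V} (h : v ∈ U) :
    glueColoring U f g v = Fin.castAdd y (f ⟨v, h⟩) :=
  dif_pos h

theorem glueColoring_of_notMem {v : V} (h : v ∉ U) :
    glueColoring U f g v = Fin.natAdd x (g ⟨v, Finset.mem_coe.2 (Finset.mem_compl.2 h)⟩) :=
  dif_neg h

theorem glueColoring_lt_iff {v : V} : (glueColoring U f g v : ℕ) < x ↔ v ∈ U := by
  by_cases h : v ∈ U
  · simp [glueColoring_of_mem h, h]
  · simp [glueColoring_of_notMem h, h]

theorem glueColoring_proper {G : SimpleGraph V}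
    (hf : ∀ u v, (G.induce (↑U : Set V)).Adj u v → f u ≠ f v)
    (hg : ∀ u v, (G.induce (↑(Uᶜ) : Set V)).Adj u v → g u ≠ g v)
    (u v : V) (huv : G.Adj u v) : glueColoring U f g u ≠ glueColoring U f g v := by
  intro heq
  have hiff : u ∈ U ↔ v ∈ U := by
    rw [← glueColoring_lt_iff (f := f) (g := g), heq, glueColoring_lt_iff]
  by_cases hu : u ∈ U
  · rw [glueColoring_of_mem hu, glueColoring_of_mem (hiff.1 hu)] at heq
    exact hf ⟨u, hu⟩ ⟨v, hiff.1 hu⟩ huv (Fin.castAdd_injective x y heq)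
  · have hv : v ∉ U := mt hiff.2 hu
    rw [glueColoring_of_notMem hu, glueColoring_of_notMem hv] at heq
    exact hg _ _ (by simpa using huv) (Fin.natAdd_injective y x heq)

end glueColoring

/-- The chromatic polynomial is binomial:
`χ_G(x+y) = Σ_{U ⊆ V(G)} χ_{G|U}(x) · χ_{G|Uᶜ}(y)`. -/
theorem chromatic_binomial {V : Type} [Fintype V] [DecidableEq V]
    (G : SimpleGraph V) (x y : ℕ) :
    chromVal G (x + y)
      = ∑ U : Finset V,
          chromVal (G.induce (↑U : Set V)) x * chromVal (G.induce (↑(Uᶜ) : Set V)) y := by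
  have hcard : ∀ U : Finset V,
      chromVal (G.induce (↑U : Set V)) x * chromVal (G.induce (↑(Uᶜ) : Set V)) y =
        Nat.card ({f : (↑U : Set V) → Fin x //
            ∀ u v, (G.induce (↑U : Set V)).Adj u v → f u ≠ f v} ×
          {g : (↑(Uᶜ) : Set V) → Fin y //
            ∀ u v, (G.induce (↑(Uᶜ) : Set V)).Adj u v → g u ≠ g v}) :=
    fun U => (Nat.card_prod _ _).symm
  simp_rw [hcard]
  rw [← Nat.card_sigma, chromVal]
  refine (Nat.card_eq_of_bijective
    (fun p => ⟨glueColoring p.1 p.2.1.1 p.2.2.1,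
      glueColoring_proper p.2.1.2 p.2.2.2⟩) ⟨?_, ?_⟩).symm
  · rintro ⟨U, ⟨f, hf⟩, ⟨g, hg⟩⟩ ⟨U', ⟨f', hf'⟩, ⟨g', hg'⟩⟩ h
    have h : ∀ v, glueColoring U f g v = glueColoring U' f' g' v :=
      congrFun (congrArg Subtype.val h)
    obtain rfl : U = U' := by
      ext v
      rw [← glueColoring_lt_iff (f := f) (g := g), h, glueColoring_lt_iff]
    obtain rfl : f = f' := by
      ext1 ⟨v, hv⟩
      have hv' := h v
      rw [glueColoring_of_mem hv, glueColoring_of_mem hv] at hv'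
      exact Fin.castAdd_injective x y hv'
    obtain rfl : g = g' := by
      ext1 ⟨v, hv⟩
      have hvU : v ∉ U := Finset.mem_compl.1 (Finset.mem_coe.1 hv)
      have hv' := h v
      rw [glueColoring_of_notMem hvU, glueColoring_of_notMem hvU] at hv'
      exact Fin.natAdd_injective y x hv'
    rfl
  · rintro ⟨φ, hφ⟩
    let U : Finset V := {v | (φ v : ℕ) < x}
    have hU : ∀ v, v ∈ U ↔ (φ v : ℕ) < x := fun v => by simp [U]
    have hUc : ∀ v : (↑(Uᶜ) : Set V), x ≤ (φ v : ℕ) := fun v =>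
      not_lt.1 (mt (hU v).2 (Finset.mem_compl.1 (Finset.mem_coe.1 v.2)))
    refine ⟨⟨U, ⟨fun v => ⟨φ v, (hU v).1 v.2⟩, fun u v huv heq => ?_⟩,
      ⟨fun v => ⟨φ v - x, by have := hUc v; omega⟩, fun u v huv heq => ?_⟩⟩, ?_⟩
    · exact hφ u v huv (Fin.ext (Fin.mk.inj_iff.1 heq))
    · have := hUc u
      have := hUc v
      have := Fin.mk.inj_iff.1 heq
      exact hφ u v (by simpa using huv) (Fin.ext (by omega))
    · ext v
      by_cases hv : v ∈ U
      · simp [glueColoring_of_mem hv]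
      · have := mt (hU v).2 hv
        simp only [glueColoring_of_notMem hv, Fin.val_natAdd]
        omega
end

section
/- The Abel polynomial of graphs is umbral: for every finite simple graph G, A_G(q′ + q″) = Σ_{U ⊆ V(G)} A_{G|_U}(q′) · A_{G|_{V(G)∖U}}(q″), an identity of polynomials in the two families of variables q′₁, q′₂, … and q″₁, q″₂, …, where A_G(q′+q″) denotes the result of substituting qᵢ ↦ q′ᵢ + q″ᵢ into A_G and the sum is over all subsets U of the vertex set. -/
open Classical in
/-- The Abel polynomial of a finite simple graph `G`: the sum over all spanning forests `F`
of `G` of the product, over the connected components `T` of the spanning subgraph `(V(G), F)`,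
of `|V(T)| · q_{|V(T)|}`, an element of `ℤ[q₁, q₂, …] = MvPolynomial ℕ ℤ`
(the variable `qᵢ` is `MvPolynomial.X i`). -/
noncomputable def abelPoly {V : Type} [Fintype V] [DecidableEq V] (G : SimpleGraph V) :
    MvPolynomial ℕ ℤ :=
  ∑ F : Finset (Sym2 V),
    if (↑F : Set (Sym2 V)) ⊆ G.edgeSet ∧ (SimpleGraph.fromEdgeSet (↑F : Set (Sym2 V))).IsAcyclic then
      ∏ᶠ c : (SimpleGraph.fromEdgeSet (↑F : Set (Sym2 V))).ConnectedComponent,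
        ((Nat.card {v : V // (SimpleGraph.fromEdgeSet (↑F : Set (Sym2 V))).connectedComponentMk v = c} :
            MvPolynomial ℕ ℤ) *
          MvPolynomial.X
            (Nat.card {v : V // (SimpleGraph.fromEdgeSet (↑F : Set (Sym2 V))).connectedComponentMk v = c}))
    else 0

namespace SimpleGraph

/-- No edge of `H` joins `s` to its complement. -/
def Separates {V : Type*} (H : SimpleGraph V) (s : Set V) : Prop :=
  ∀ ⦃u v⦄, H.Adj u v → (u ∈ s ↔ v ∈ s)

section Separates

variable {V : Type*} {H : SimpleGraph V} {s : Set V}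

lemma Separates.compl (h : H.Separates s) : H.Separates sᶜ :=
  fun _ _ huv => not_congr (h huv)

lemma Separates.mem_of_mem_support (h : H.Separates s) {u v : V} (p : H.Walk u v) (hu : u ∈ s) :
    ∀ w ∈ p.support, w ∈ s := by
  induction p with
  | nil => simpa using hu
  | cons huv p ih =>
    intro w hw
    rcases List.mem_cons.1 (by simpa using hw) with rfl | hw
    · exact hu
    · exact ih ((h huv).1 hu) w hw

lemma Separates.reachable_induce (h : H.Separates s) {u v : s} (huv : H.Reachable u v) :
    (H.induce s).Reachable u v := by
  obtain ⟨p⟩ := huv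
  exact ⟨p.induce s (h.mem_of_mem_support p u.2)⟩

lemma Separates.isAcyclic_iff (h : H.Separates s) :
    H.IsAcyclic ↔ (H.induce s).IsAcyclic ∧ (H.induce sᶜ).IsAcyclic := by
  refine ⟨fun hH => ⟨hH.induce s, hH.induce sᶜ⟩, fun ⟨h₁, h₂⟩ v p hp => ?_⟩
  have key : ∀ t : Set V, H.Separates t → (H.induce t).IsAcyclic → v ∉ t := by
    intro t ht hac hv
    refine hac (p.induce t (ht.mem_of_mem_support p hv)) ?_
    rw [← Walk.isCycle_map_iff_of_injective (f := (Embedding.induce (G := H) t).toHom)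
      (Embedding.induce (G := H) t).injective, Walk.map_induce]
    exact hp
  exact key sᶜ h.compl h₂ (key s h h₁)

/-- The product of `f |C|` over the connected components `C` of `H`. -/
noncomputable def componentProd {R : Type*} [CommRing R] (H : SimpleGraph V) (f : ℕ → R) : R :=
  ∏ᶠ c : H.ConnectedComponent, f (Nat.card c.supp)

lemma Separates.componentProd_induce {R : Type*} [CommRing R] (h : H.Separates s) (f : ℕ → R) :
    (H.induce s).componentProd f =
      ∏ᶠ c ∈ {c : H.ConnectedComponent | c.supp ⊆ s}, f (Nat.card c.supp) := by
  have supp_map : ∀ c : (H.induce s).ConnectedComponent,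
      (c.map (Embedding.induce s).toHom).supp = Subtype.val '' c.supp := by
    intro c
    induction c using ConnectedComponent.ind with | _ u =>
    ext v
    simp only [ConnectedComponent.map_mk, ConnectedComponent.mem_supp_iff, ConnectedComponent.eq,
      Set.mem_image]
    constructor
    · intro hv
      have hvs : v ∈ s := by
        obtain ⟨p⟩ := hv.symm
        exact h.mem_of_mem_support p u.2 v p.end_mem_support
      exact ⟨⟨v, hvs⟩, h.reachable_induce hv, rfl⟩
    · rintro ⟨w, hw, rfl⟩
      exact hw.map (Embedding.induce s).toHom
  rw [componentProd, ← finprod_mem_univ]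
  refine finprod_mem_eq_of_bijOn (fun c => c.map (Embedding.induce s).toHom) ⟨?_, ?_, ?_⟩ ?_
  · intro c _
    simp [supp_map]
  · intro c _ d _ hcd
    have := congrArg ConnectedComponent.supp hcd
    simp only [supp_map] at this
    exact ConnectedComponent.supp_injective (Subtype.val_injective.image_injective this)
  · intro c hc
    induction c using ConnectedComponent.ind with | _ v =>
    exact ⟨(H.induce s).connectedComponentMk ⟨v, hc rfl⟩, trivial, rfl⟩
  · intro c _
    simp only [supp_map]
    rw [Nat.card_image_of_injective Subtype.val_injective]

end Separates

open Classical in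
lemma componentProd_add {V R : Type*} [Fintype V] [CommRing R] (H : SimpleGraph V) (f g : ℕ → R) :
    H.componentProd (f + g) = ∑ U ∈ Finset.univ.filter (fun U : Finset V => H.Separates ↑U),
      (H.induce (↑U : Set V)).componentProd f *
        (H.induce (↑U : Set V)ᶜ).componentProd g := by
  have := Fintype.ofFinite H.ConnectedComponent
  have key : ∀ t : Finset H.ConnectedComponent,
      H.Separates {v | H.connectedComponentMk v ∈ t} := fun t u v huv => by
    simp [ConnectedComponent.sound huv.reachable]
  have sub : ∀ (t : Finset H.ConnectedComponent) (c : H.ConnectedComponent),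
      c.supp ⊆ {v | H.connectedComponentMk v ∈ t} ↔ c ∈ t := by
    intro t c
    induction c using ConnectedComponent.ind with | _ v =>
    refine ⟨fun hc => hc rfl, fun hc w hw => ?_⟩
    rw [ConnectedComponent.mem_supp_iff] at hw
    simpa [hw] using hc
  rw [componentProd, finprod_eq_prod_of_fintype]
  simp only [Pi.add_apply]
  rw [Finset.prod_add]
  refine Finset.sum_bij' (fun t _ => Finset.univ.filter (fun v => H.connectedComponentMk v ∈ t))
    (fun U _ => Finset.univ.filter (fun c : H.ConnectedComponent => c.supp ⊆ ↑U)) ?_ ?_ ?_ ?_ ?_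
  · intro t _
    simpa using key t
  · simp
  · intro t _
    ext c
    simpa using sub t c
  · intro U hU
    simp only [Finset.mem_filter, Finset.mem_univ, true_and] at hU
    ext v
    simp only [Finset.mem_filter, Finset.mem_univ, true_and]
    refine ⟨fun hv => hv rfl, fun hv w hw => ?_⟩
    obtain ⟨p⟩ := (ConnectedComponent.exact hw).symm
    exact hU.mem_of_mem_support p hv w p.end_mem_support
  · intro t _
    have hcoe : (↑({v | H.connectedComponentMk v ∈ t} : Finset V) : Set V) =
        {v | H.connectedComponentMk v ∈ t} := by simp
    have hcompl : ({v | H.connectedComponentMk v ∈ t}ᶜ : Set V) =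
        {v | H.connectedComponentMk v ∈ tᶜ} := by ext; simp
    rw [hcoe, (key t).componentProd_induce, (key t).compl.componentProd_induce]
    have hset : ∀ t : Finset H.ConnectedComponent, {c | c ∈ t} = (↑t : Set H.ConnectedComponent) :=
      fun t => by ext; simp
    simp only [hcompl, sub, hset]
    rw [finprod_mem_coe_finset, finprod_mem_coe_finset, Finset.compl_eq_univ_sdiff]

open Classical in
/-- The sum of `componentProd F f` over the spanning forests `F` of `G`. -/
noncomputable def forestSum {V R : Type*} [Fintype V] [CommRing R] (G : SimpleGraph V)
    (f : ℕ → R) : R :=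
  ∑ F : SimpleGraph V with F ≤ G ∧ F.IsAcyclic, F.componentProd f

/-- The union of a graph on `s` and a graph on `sᶜ`. -/
def glue {V : Type*} {s : Set V} (A : SimpleGraph s) (B : SimpleGraph ↥sᶜ) : SimpleGraph V :=
  A.map (Function.Embedding.subtype _) ⊔ B.map (Function.Embedding.subtype _)

section Glue

variable {V : Type*} {s : Set V} (A : SimpleGraph s) (B : SimpleGraph ↥sᶜ)

lemma separates_glue : (glue A B).Separates s := by
  rintro u v (⟨-, a, b, -, rfl, rfl⟩ | ⟨-, a, b, -, rfl, rfl⟩)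
  · simp
  · exact iff_of_false a.2 b.2

lemma induce_glue_left : (glue A B).induce s = A := by
  ext u v
  simp only [glue, comap_adj, sup_adj, map_adj]
  constructor
  · rintro (⟨a, b, hab, ha, hb⟩ | ⟨a, b, hab, ha, hb⟩)
    · rwa [Subtype.ext ha, Subtype.ext hb] at hab
    · exact absurd ((congrArg (· ∈ s) ha).mpr u.2) a.2
  · exact fun h => Or.inl ⟨u, v, h, rfl, rfl⟩

lemma induce_glue_right : (glue A B).induce sᶜ = B := by
  ext u v
  simp only [glue, comap_adj, sup_adj, map_adj]
  constructor
  · rintro (⟨a, b, hab, ha, hb⟩ | ⟨a, b, hab, ha, hb⟩)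
    · exact absurd ((congrArg (· ∈ s) ha).mp a.2) u.2
    · rwa [Subtype.ext ha, Subtype.ext hb] at hab
  · exact fun h => Or.inr ⟨u, v, h, rfl, rfl⟩

lemma Separates.glue_induce {H : SimpleGraph V} (h : H.Separates s) :
    glue (H.induce s) (H.induce sᶜ) = H := by
  ext u v
  simp only [glue, comap_adj, sup_adj, map_adj]
  constructor
  · rintro (⟨a, b, hab, rfl, rfl⟩ | ⟨a, b, hab, rfl, rfl⟩) <;> exact hab
  · intro huv
    by_cases hu : u ∈ s
    · exact Or.inl ⟨⟨u, hu⟩, ⟨v, (h huv).1 hu⟩, huv, rfl, rfl⟩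
    · exact Or.inr ⟨⟨u, hu⟩, ⟨v, (h.compl huv).1 hu⟩, huv, rfl, rfl⟩

lemma Separates.le_iff {H G : SimpleGraph V} (h : H.Separates s) :
    H ≤ G ↔ H.induce s ≤ G.induce s ∧ H.induce sᶜ ≤ G.induce sᶜ := by
  refine ⟨fun hH => ⟨fun _ _ h => hH h, fun _ _ h => hH h⟩, fun ⟨h₁, h₂⟩ u v huv => ?_⟩
  by_cases hu : u ∈ s
  · exact h₁ (show (H.induce s).Adj ⟨u, hu⟩ ⟨v, (h huv).1 hu⟩ from huv)
  · exact h₂ (show (H.induce sᶜ).Adj ⟨u, hu⟩ ⟨v, (h.compl huv).1 hu⟩ from huv)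

end Glue

open Classical in
lemma forestSum_add {V R : Type*} [Fintype V] [CommRing R] (G : SimpleGraph V) (f g : ℕ → R) :
    G.forestSum (f + g) = ∑ U : Finset V,
      (G.induce (↑U : Set V)).forestSum f * (G.induce (↑U : Set V)ᶜ).forestSum g := by
  simp only [forestSum, componentProd_add]
  rw [Finset.sum_comm' (s' := fun U : Finset V => {F | (F ≤ G ∧ F.IsAcyclic) ∧ F.Separates ↑U})
    (t' := Finset.univ) (by simp)]
  refine Finset.sum_congr rfl fun U _ => ?_
  rw [Finset.sum_mul_sum, ← Finset.sum_product']
  refine Finset.sum_bij'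
    (fun F _ => (F.induce (↑U : Set V), F.induce (↑U : Set V)ᶜ)) (fun p _ => glue p.1 p.2)
    ?_ ?_ ?_ ?_ ?_
  · intro F hF
    simp only [Finset.mem_filter, Finset.mem_univ, true_and] at hF
    have h₁ := hF.2.le_iff.1 hF.1.1
    have h₂ := hF.2.isAcyclic_iff.1 hF.1.2
    simp only [Finset.mem_product, Finset.mem_filter, Finset.mem_univ, true_and]
    exact ⟨⟨h₁.1, h₂.1⟩, h₁.2, h₂.2⟩
  · rintro ⟨A, B⟩ h
    simp only [Finset.mem_product, Finset.mem_filter, Finset.mem_univ, true_and] at h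
    simp only [Finset.mem_filter, Finset.mem_univ, true_and]
    refine ⟨⟨(separates_glue A B).le_iff.2 ?_, (separates_glue A B).isAcyclic_iff.2 ?_⟩,
      separates_glue A B⟩
    · rw [induce_glue_left, induce_glue_right]
      exact ⟨h.1.1, h.2.1⟩
    · rw [induce_glue_left, induce_glue_right]
      exact ⟨h.1.2, h.2.2⟩
  · intro F hF
    exact (Finset.mem_filter.1 hF).2.2.glue_induce
  · rintro ⟨A, B⟩ _
    simp only [induce_glue_left, induce_glue_right]
  · intro F _
    rfl

lemma map_componentProd {V R S : Type*} [Finite V] [CommRing R] [CommRing S] (φ : R →+* S)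
    (H : SimpleGraph V) (f : ℕ → R) :
    φ (H.componentProd f) = H.componentProd (fun n => φ (f n)) := by
  have := Fintype.ofFinite H.ConnectedComponent
  simp only [componentProd, finprod_eq_prod_of_fintype, map_prod]

lemma map_forestSum {V R S : Type*} [Fintype V] [CommRing R] [CommRing S] (φ : R →+* S)
    (G : SimpleGraph V) (f : ℕ → R) :
    φ (G.forestSum f) = G.forestSum (fun n => φ (f n)) := by
  simp only [forestSum, map_sum, map_componentProd]

end SimpleGraph

open SimpleGraph in
lemma abelPoly_eq_forestSum {V : Type} [Fintype V] [DecidableEq V] (G : SimpleGraph V) :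
    abelPoly G = G.forestSum (fun n => (n : MvPolynomial ℕ ℤ) * MvPolynomial.X n) := by
  classical
  rw [abelPoly, forestSum, ← Finset.sum_filter]
  refine Finset.sum_bij' (fun F _ => fromEdgeSet (↑F : Set (Sym2 V)))
    (fun H _ => H.edgeFinset) ?_ ?_ ?_ ?_ ?_
  · intro F hF
    simp only [Finset.mem_filter, Finset.mem_univ, true_and] at hF ⊢
    refine ⟨?_, hF.2⟩
    rw [← fromEdgeSet_edgeSet (G := G)]
    exact fromEdgeSet_mono hF.1
  · intro H hH
    simpa using hH
  · intro F hF
    simp only [Finset.mem_filter, Finset.mem_univ, true_and] at hF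
    rw [← Finset.coe_inj, coe_edgeFinset, edgeSet_fromEdgeSet, sdiff_eq_left]
    exact Set.disjoint_left.2 fun e he => G.not_isDiag_of_mem_edgeSet (hF.1 he)
  · intro H _
    simp
  · intro F _
    rfl

/-- The Abel polynomial of graphs is umbral:
`A_G(q′ + q″) = Σ_{U ⊆ V(G)} A_{G|U}(q′) · A_{G|Uᶜ}(q″)`. -/
theorem abel_is_umbral {V : Type} [Fintype V] [DecidableEq V] (G : SimpleGraph V) :
    MvPolynomial.aeval
        (fun i : ℕ =>
          (MvPolynomial.X (Sum.inl i) + MvPolynomial.X (Sum.inr i) : MvPolynomial (ℕ ⊕ ℕ) ℤ))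
        (abelPoly G)
      = ∑ U : Finset V,
          MvPolynomial.rename Sum.inl (abelPoly (G.induce (↑U : Set V))) *
            MvPolynomial.rename Sum.inr (abelPoly (G.induce (↑(Uᶜ) : Set V))) := by
  have hcompl : ∀ U : Finset V, abelPoly (G.induce (↑(Uᶜ) : Set V)) =
      (G.induce (↑U : Set V)ᶜ).forestSum
        (fun n => (n : MvPolynomial ℕ ℤ) * MvPolynomial.X n) := by
    classical
    intro U
    rw [abelPoly_eq_forestSum]
    congr! <;> simp
  simp only [hcompl, abelPoly_eq_forestSum, ← AlgHom.coe_toRingHom, SimpleGraph.map_forestSum]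
  convert SimpleGraph.forestSum_add G
    (fun n => (n : MvPolynomial (ℕ ⊕ ℕ) ℤ) * MvPolynomial.X (Sum.inl n))
    (fun n => (n : MvPolynomial (ℕ ⊕ ℕ) ℤ) * MvPolynomial.X (Sum.inr n)) using 2
  · ext1 n
    simp [mul_add]
  · simp
    left
    congr!
end

section
/- Let σ be a chord diagram with n chords on ZMod(2n), represent its points by 0, 1, …, 2n−1, and number the chords 1, …, n in increasing order of their smaller endpoint. Let M be the n×n integer matrix with M_{ij} = 1 if chords i and j interlace and i < j, M_{ij} = −1 if they interlace and i > j, and M_{ij} = 0 otherwise. Then det(x·I − M) = Q_{g(σ)}(x) in ℤ[x]: the characteristic polynomial of the skew-symmetric adjacency matrix M of the directed intersection graph equals the skew characteristic polynomial of the intersection graph; in particular it does not depend on the choice of the cut point (it is unchanged when σ is conjugated by a rotation i ↦ i + 1 of ZMod(2n)). -/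
open Classical in
/-- The adjacency matrix of a finite simple graph over the two-element field `F₂ = ZMod 2`. -/
noncomputable def adjMat {V : Type} [Fintype V] (G : SimpleGraph V) : Matrix V V (ZMod 2) :=
  fun i j => if G.Adj i j then 1 else 0

open Classical in
/-- The skew characteristic polynomial of a finite simple graph `G` with `n` vertices:
`Q_G(x) = Σ_{U ⊆ V(G), G|_U nondegenerate over F₂} x^{n − |U|}`. -/
noncomputable def skewCharPoly {V : Type} [Fintype V] [DecidableEq V] (G : SimpleGraph V) :
    Polynomial ℤ :=
  ∑ U : Finset V,
    if IsUnit (adjMat (G.induce (↑U : Set V))).det then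
      (Polynomial.X : Polynomial ℤ) ^ (Fintype.card V - U.card)
    else 0

instance neZero_two_mul (n : ℕ) [NeZero n] : NeZero (2 * n) :=
  ⟨by have := NeZero.ne n; omega⟩

/-- `btwn a c x` : the point `x` lies in the open cyclic interval `{a+1, a+2, …, c−1}`
of `ZMod m`. -/
def btwn {m : ℕ} (a c x : ZMod m) : Prop :=
  0 < (x - a).val ∧ (x - a).val < (c - a).val

/-- The chords `{p, σ p}` and `{q, σ q}` of `σ` interlace: exactly one of `q`, `σ q` lies in
the cyclic interval `{p+1, …, σ p − 1}`. -/
def interlace {m : ℕ} (σ : ZMod m → ZMod m) (p q : ZMod m) : Prop :=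
  Xor' (btwn p (σ p) q) (btwn p (σ p) (σ q))

/-- The intersection graph of a chord diagram `σ`: vertices are the chords of `σ`
(represented by their smaller endpoints), two distinct chords being adjacent iff
they interlace. -/
def intersectionGraph {m : ℕ} (σ : ZMod m → ZMod m) :
    SimpleGraph {p : ZMod m // p.val < (σ p).val} :=
  SimpleGraph.fromRel fun p q => interlace σ p.1 q.1

open Classical in
/-- The skew-symmetric integer adjacency matrix of the directed intersection graph of a
chord diagram `σ`, the chords being numbered in increasing order of their smaller
endpoints: the `(p,q)` entry is `1` if the chords `p` and `q` interlace and `p < q`,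
`-1` if they interlace and `q < p`, and `0` otherwise. -/
noncomputable def dirAdjMat {m : ℕ} (σ : ZMod m → ZMod m) :
    Matrix {p : ZMod m // p.val < (σ p).val} {p : ZMod m // p.val < (σ p).val} ℤ :=
  fun p q =>
    if interlace σ p.1 q.1 then
      if p.1.val < q.1.val then 1 else if q.1.val < p.1.val then -1 else 0
    else 0
/-- The indicator of `x < y`. -/
def ltInd (x y : ℤ) : ℤ := if x < y then 1 else 0

theorem ltInd_swap {x y : ℤ} (h : x ≠ y) : ltInd y x = 1 - ltInd x y := by
  grind [ltInd]

theorem exists_block_exchange {p₁ p₂ p₃ p₄ : ℤ} (h₁₂ : p₁ < p₂) (h₂₃ : p₂ < p₃) (h₃₄ : p₃ < p₄)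
    (K : ℤ) : ∃ f : ℤ → ℤ, ∀ x y, |x| < K → |y| < K → x ≠ y →
      x ∉ ({p₁, p₂, p₃, p₄} : Set ℤ) → y ∉ ({p₁, p₂, p₃, p₄} : Set ℤ) →
      f x ≠ f y ∧ ltInd (f x) (f y) = ltInd x y +
        ((ltInd x p₂ - ltInd x p₄) * (ltInd y p₁ - ltInd y p₃) -
          (ltInd x p₁ - ltInd x p₃) * (ltInd y p₂ - ltInd y p₄)) := by
  refine ⟨fun x => if x < p₁ then x else if x < p₂ then x + 6 * K else if x < p₃ then x + 4 * K
    else if x < p₄ then x + 2 * K else x + 8 * K, fun x y hx hy hxy hxp hyp => ?_⟩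
  rw [abs_lt] at hx hy
  simp only [Set.mem_insert_iff, Set.mem_singleton_iff, not_or] at hxp hyp
  have region : ∀ z : ℤ, ¬ (z = p₁ ∨ z = p₂ ∨ z = p₃ ∨ z = p₄) →
      (z < p₁ ∧ z < p₂ ∧ z < p₃ ∧ z < p₄) ∨ (¬ z < p₁ ∧ z < p₂ ∧ z < p₃ ∧ z < p₄) ∨
      (¬ z < p₁ ∧ ¬ z < p₂ ∧ z < p₃ ∧ z < p₄) ∨ (¬ z < p₁ ∧ ¬ z < p₂ ∧ ¬ z < p₃ ∧ z < p₄) ∨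
      (¬ z < p₁ ∧ ¬ z < p₂ ∧ ¬ z < p₃ ∧ ¬ z < p₄) := by omega
  unfold ltInd
  obtain ⟨a₁, a₂, a₃, a₄⟩ | ⟨a₁, a₂, a₃, a₄⟩ | ⟨a₁, a₂, a₃, a₄⟩ | ⟨a₁, a₂, a₃, a₄⟩ |
    ⟨a₁, a₂, a₃, a₄⟩ := region x (by tauto) <;>
  obtain ⟨b₁, b₂, b₃, b₄⟩ | ⟨b₁, b₂, b₃, b₄⟩ | ⟨b₁, b₂, b₃, b₄⟩ | ⟨b₁, b₂, b₃, b₄⟩ |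
    ⟨b₁, b₂, b₃, b₄⟩ := region y (by tauto) <;>
  simp only [a₁, a₂, a₃, a₄, b₁, b₂, b₃, b₄, if_true, if_false] <;>
  exact ⟨by omega, by split_ifs <;> omega⟩

/-- The signed crossing number of the chords from `a` to `b` and from `c` to `d`. -/
def crossing (a b c d : ℤ) : ℤ := ltInd a c - ltInd a d - ltInd b c + ltInd b d

theorem exists_pivot {a b c d : ℤ} (had : a ≠ d) (hbc : b ≠ c)
    (hbd : b ≠ d) (hcd : c ≠ d) (h : crossing a b c d = 1) (K : ℤ) :
    ∃ f : ℤ → ℤ, ∀ x y, |x| < K → |y| < K → x ≠ y →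
      x ∉ ({a, b, c, d} : Set ℤ) → y ∉ ({a, b, c, d} : Set ℤ) →
      f x ≠ f y ∧ ltInd (f x) (f y) = ltInd x y +
        ((ltInd x c - ltInd x d) * (ltInd y a - ltInd y b) -
          (ltInd x a - ltInd x b) * (ltInd y c - ltInd y d)) := by
  have hcases : (a < c ∧ c < b ∧ b < d) ∨ (c < b ∧ b < d ∧ d < a) ∨ (b < d ∧ d < a ∧ a < c) ∨
      (d < a ∧ a < c ∧ c < b) := by
    unfold crossing ltInd at h
    split_ifs at h <;> omega
  obtain ⟨h₁, h₂, h₃⟩ | ⟨h₁, h₂, h₃⟩ | ⟨h₁, h₂, h₃⟩ | ⟨h₁, h₂, h₃⟩ := hcases <;>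
  · obtain ⟨f, hf⟩ := exists_block_exchange h₁ h₂ h₃ K
    refine ⟨f, fun x y hx hy hxy hxp hyp => ?_⟩
    simp only [Set.mem_insert_iff, Set.mem_singleton_iff, not_or] at hxp hyp hf
    obtain ⟨h₄, h₅⟩ := hf x y hx hy hxy (by tauto) (by tauto)
    exact ⟨h₄, h₅.trans (by ring)⟩

/-- The skew-symmetric matrix of signed crossing numbers of the chords from `a v` to `b v`. -/
def crossingMat {V : Type} [DecidableEq V] (a b : V → ℤ) : Matrix V V ℤ :=
  fun k l => if k = l then 0 else crossing (a k) (b k) (a l) (b l)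

/-- All endpoints of the chords from `a v` to `b v` are distinct. -/
structure DistinctEnds {V : Type} (a b : V → ℤ) : Prop where
  tail_ne_tail : ∀ k l, k ≠ l → a k ≠ a l
  head_ne_head : ∀ k l, k ≠ l → b k ≠ b l
  tail_ne_head : ∀ k l, a k ≠ b l

theorem DistinctEnds.crossing_swap {V : Type} {a b : V → ℤ}
    (h : DistinctEnds a b) {k l : V} (hkl : k ≠ l) :
    crossing (a l) (b l) (a k) (b k) = - crossing (a k) (b k) (a l) (b l) := by
  unfold crossing
  rw [ltInd_swap (h.tail_ne_tail k l hkl), ltInd_swap (h.head_ne_head k l hkl),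
    ltInd_swap (h.tail_ne_head k l), ltInd_swap (h.tail_ne_head l k).symm]
  ring

/-- The inclusion of two distinct elements, together with the inclusion of the others. -/
noncomputable def pairSumEquiv {V : Type} {i j : V} (hij : i ≠ j) :
    Fin 2 ⊕ {v : V // v ≠ i ∧ v ≠ j} ≃ V :=
  Equiv.ofBijective (Sum.elim ![i, j] Subtype.val) <| by
    constructor
    · rintro (x | ⟨x, hx⟩) (y | ⟨y, hy⟩) hxy
      · fin_cases x <;> fin_cases y <;> simp_all
      · fin_cases x
        · exact absurd hxy.symm hy.1
        · exact absurd hxy.symm hy.2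
      · fin_cases y
        · exact absurd hxy hx.1
        · exact absurd hxy hx.2
      · exact congrArg _ (Subtype.ext hxy)
    · intro v
      by_cases h₁ : v = i
      · exact ⟨.inl 0, by simp [h₁]⟩
      by_cases h₂ : v = j
      · exact ⟨.inl 1, by simp [h₂]⟩
      exact ⟨.inr ⟨v, h₁, h₂⟩, rfl⟩

theorem Matrix.det_eq_det_pivot {V : Type} [Fintype V] [DecidableEq V] (M : Matrix V V ℤ)
    {i j : V} (hij : i ≠ j) (hii : M i i = 0) (hjj : M j j = 0) (h₁ : M i j = 1)
    (h₂ : M j i = -1) :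
    M.det = (Matrix.of fun k l : {v : V // v ≠ i ∧ v ≠ j} =>
      M k l + M k i * M j l - M k j * M i l).det := by
  rw [← Matrix.det_submatrix_equiv_self (pairSumEquiv hij)]
  let A : Matrix (Fin 2) (Fin 2) ℤ := !![0, 1; -1, 0]
  let A' : Matrix (Fin 2) (Fin 2) ℤ := !![0, -1; 1, 0]
  have hA : M.submatrix (pairSumEquiv hij) (pairSumEquiv hij) = Matrix.fromBlocks A
      (M.submatrix ![i, j] Subtype.val) (M.submatrix Subtype.val ![i, j])
      (M.submatrix Subtype.val Subtype.val) := by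
    ext (k | k) (l | l)
    · fin_cases k <;> fin_cases l <;> simpa [pairSumEquiv, A]
    all_goals rfl
  let _ : Invertible A := ⟨A', by simp [A, A', Matrix.one_fin_two], by
    simp [A, A', Matrix.one_fin_two]⟩
  have hinv : ⅟A = A' := rfl
  rw [hA, Matrix.det_fromBlocks₁₁, hinv]
  have hdet : A.det = 1 := by simp [A, Matrix.det_fin_two]
  rw [hdet, one_mul]
  congr 1
  ext k l
  simp only [Matrix.sub_apply, Matrix.mul_apply, Fin.sum_univ_two, Matrix.of_apply]
  simp [A']
  ring

theorem crossing_values (a b c d : ℤ) :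
    crossing a b c d = 0 ∨ crossing a b c d = 1 ∨ crossing a b c d = -1 := by
  unfold crossing ltInd
  split_ifs <;> omega

theorem DistinctEnds.det_crossingMat {n : ℕ} : ∀ {V : Type} [Fintype V] [DecidableEq V]
    {a b : V → ℤ}, DistinctEnds a b → Fintype.card V = n →
      (crossingMat a b).det = 0 ∨ (crossingMat a b).det = 1 := by
  induction n using Nat.strong_induction_on with
  | _ n ih =>
  intro V _ _ a b h hn
  rcases isEmpty_or_nonempty V with hV | hV
  · exact Or.inr Matrix.det_isEmpty
  by_cases hM : crossingMat a b = 0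
  · left; rw [hM]; exact Matrix.det_zero
  obtain ⟨i, j, hij, hcr⟩ : ∃ i j, i ≠ j ∧ crossing (a i) (b i) (a j) (b j) = 1 := by
    by_contra! hne
    refine hM (Matrix.ext fun k l => ?_)
    rcases eq_or_ne k l with hkl | hkl
    · simp [crossingMat, hkl]
    have h₁ := hne k l hkl
    have h₂ := hne l k hkl.symm
    rw [h.crossing_swap hkl] at h₂
    have := crossing_values (a k) (b k) (a l) (b l)
    simp only [crossingMat, hkl, if_false, Matrix.zero_apply]
    omega
  obtain ⟨K, hK⟩ : ∃ K : ℤ, ∀ v, |a v| < K ∧ |b v| < K := by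
    refine ⟨∑ v, (|a v| + |b v|) + 1, fun v => ?_⟩
    have := Finset.single_le_sum (f := fun v => |a v| + |b v|) (fun v _ => by positivity)
      (Finset.mem_univ v)
    have h₁ := abs_nonneg (a v)
    have h₂ := abs_nonneg (b v)
    constructor <;> omega
  obtain ⟨f, hf⟩ := exists_pivot (h.tail_ne_head i j) (h.tail_ne_head j i).symm
    (h.head_ne_head i j hij) (h.tail_ne_head j j) hcr K
  have hta : ∀ v : {v : V // v ≠ i ∧ v ≠ j}, a v ∉ ({a i, b i, a j, b j} : Set ℤ) := fun v => by
    simp [h.tail_ne_tail v i v.2.1, h.tail_ne_tail v j v.2.2, h.tail_ne_head]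
  have htb : ∀ v : {v : V // v ≠ i ∧ v ≠ j}, b v ∉ ({a i, b i, a j, b j} : Set ℤ) := fun v => by
    simp [h.head_ne_head v i v.2.1, h.head_ne_head v j v.2.2, (h.tail_ne_head _ _).symm]
  have hval : ∀ k l : {v : V // v ≠ i ∧ v ≠ j}, k ≠ l → (k : V) ≠ l :=
    fun k l hkl => Subtype.coe_injective.ne hkl
  have hdist : DistinctEnds (V := {v : V // v ≠ i ∧ v ≠ j}) (fun v => f (a v))
      (fun v => f (b v)) :=
    ⟨fun k l hkl => (hf _ _ (hK k).1 (hK l).1 (h.tail_ne_tail k l (hval k l hkl))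
      (hta k) (hta l)).1,
    fun k l hkl => (hf _ _ (hK k).2 (hK l).2 (h.head_ne_head k l (hval k l hkl))
      (htb k) (htb l)).1,
    fun k l => (hf _ _ (hK k).1 (hK l).2 (h.tail_ne_head k l) (hta k) (htb l)).1⟩
  have hdet : (crossingMat a b).det = (crossingMat (V := {v : V // v ≠ i ∧ v ≠ j})
      (fun v => f (a v)) (fun v => f (b v))).det := by
    rw [Matrix.det_eq_det_pivot _ hij (by simp [crossingMat]) (by simp [crossingMat])
      (by simp [crossingMat, hij, hcr])
      (by simp [crossingMat, hij.symm, h.crossing_swap hij, hcr])]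
    congr 1
    ext k l
    rw [Matrix.of_apply]
    simp only [crossingMat, k.2.1, k.2.2, l.2.1.symm, l.2.2.symm, if_false]
    rw [h.crossing_swap l.2.1, h.crossing_swap l.2.2]
    rcases eq_or_ne k l with rfl | hkl
    · simp only [if_true]; ring
    simp only [hkl, hval k l hkl, if_false]
    simp only [crossing]
    rw [(hf _ _ (hK k).1 (hK l).1 (h.tail_ne_tail k l (hval k l hkl)) (hta k) (hta l)).2,
      (hf _ _ (hK k).2 (hK l).2 (h.head_ne_head k l (hval k l hkl)) (htb k) (htb l)).2,
      (hf _ _ (hK k).1 (hK l).2 (h.tail_ne_head k l) (hta k) (htb l)).2,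
      (hf _ _ (hK k).2 (hK l).1 (h.tail_ne_head l k).symm (htb k) (hta l)).2]
    ring
  rw [hdet]
  refine ih _ ?_ hdist rfl
  rw [← hn]
  exact Fintype.card_subtype_lt (x := i) (by simp)

open Polynomial in
theorem Matrix.charpoly_eq_sum_minors {V : Type} [Fintype V] [DecidableEq V]
    (M : Matrix V V ℤ) :
    M.charpoly = ∑ U : Finset V, C ((-1) ^ U.card *
      (M.submatrix (Subtype.val : U → V) Subtype.val).det) * X ^ (Fintype.card V - U.card) := by
  ext d
  simp only [finsetSum_coeff, coeff_C_mul_X_pow]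
  rcases le_or_gt d (Fintype.card V) with hd | hd
  · have h := M.charpoly_coeff_eq_sum_minors (Fintype.card V - d) (Nat.sub_le _ _)
    rw [Nat.sub_sub_self hd] at h
    rw [h, Finset.mul_sum, ← Finset.sum_filter]
    refine Finset.sum_congr ?_ fun U hU => ?_
    · ext U
      have := U.card_le_univ
      simp only [Finset.mem_powersetCard_univ, Finset.mem_filter_univ]
      omega
    · have := U.card_le_univ
      rw [Finset.mem_filter_univ] at hU
      rw [show Fintype.card V - d = U.card by omega]
  · rw [coeff_eq_zero_of_natDegree_lt (by rwa [M.charpoly_natDegree_eq_dim])]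
    refine (Finset.sum_eq_zero fun U _ => if_neg ?_).symm
    omega

theorem btwn_iff_of_lt {m : ℕ} [NeZero m] {a c : ZMod m} (h : a.val < c.val) (x : ZMod m) :
    btwn a c x ↔ a.val < x.val ∧ x.val < c.val := by
  unfold btwn
  rw [ZMod.val_sub h.le]
  have hc := c.val_lt
  rcases le_or_gt a.val x.val with hx | hx
  · rw [ZMod.val_sub hx]; omega
  · have hne : a - x ≠ 0 := fun h0 => by simp [sub_eq_zero.mp h0] at hx
    rw [← neg_sub a x, ZMod.neg_val, if_neg hne, ZMod.val_sub hx.le]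
    omega

theorem interlace_iff_of_lt {m : ℕ} [NeZero m] (σ : ZMod m → ZMod m)
    (p q : {p : ZMod m // p.val < (σ p).val}) :
    interlace σ p q ↔ Xor (p.1.val < q.1.val ∧ q.1.val < (σ p).val)
      (p.1.val < (σ q).val ∧ (σ q).val < (σ p).val) := by
  rw [← btwn_iff_of_lt p.2, ← btwn_iff_of_lt p.2]
  rfl

theorem distinctEnds_of_involutive {m : ℕ} [NeZero m] {σ : ZMod m → ZMod m}
    (hinv : Function.Involutive σ) :
    DistinctEnds (fun p : {p : ZMod m // p.val < (σ p).val} => (p.1.val : ℤ))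
      (fun p => ((σ p).val : ℤ)) where
  tail_ne_tail k l hkl := by
    simpa [-ZMod.natCast_val, (ZMod.val_injective m).eq_iff, Subtype.ext_iff] using hkl
  head_ne_head k l hkl := by
    simpa [-ZMod.natCast_val, (ZMod.val_injective m).eq_iff, Subtype.ext_iff, hinv.injective.eq_iff]
      using hkl
  tail_ne_head k l h := by
    have h' : k.1 = σ l := ZMod.val_injective m (by exact_mod_cast h)
    have hk := k.2
    rw [h', hinv] at hk
    exact absurd hk l.2.not_gt

theorem dirAdjMat_eq_crossingMat {m : ℕ} [NeZero m] {σ : ZMod m → ZMod m}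
    (hinv : Function.Involutive σ) :
    dirAdjMat σ = crossingMat
      (fun p : {p : ZMod m // p.val < (σ p).val} => (p.1.val : ℤ)) (fun p => ((σ p).val : ℤ)) := by
  ext p q
  have h := distinctEnds_of_involutive hinv
  rcases eq_or_ne p q with rfl | hpq
  · simp [dirAdjMat, crossingMat]
  have h₁ := h.tail_ne_tail p q hpq
  have h₂ := h.head_ne_head p q hpq
  have h₃ := h.tail_ne_head p q
  have h₄ := h.tail_ne_head q p
  have hp := p.2
  have hq := q.2
  simp only [dirAdjMat, crossingMat, if_neg hpq, crossing, ltInd, interlace_iff_of_lt σ p q, Xor,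
    Nat.cast_lt, Nat.cast_inj, ne_eq] at *
  split_ifs <;> omega

theorem intersectionGraph_adj {m : ℕ} [NeZero m] {σ : ZMod m → ZMod m}
    (hinv : Function.Involutive σ) (p q : {p : ZMod m // p.val < (σ p).val}) :
    (intersectionGraph σ).Adj p q ↔ interlace σ p q := by
  have h := distinctEnds_of_involutive hinv
  rw [intersectionGraph, SimpleGraph.fromRel_adj]
  rcases eq_or_ne p q with rfl | hpq
  · simp [interlace_iff_of_lt, Xor]
  have h₁ := h.tail_ne_tail p q hpq
  have h₂ := h.head_ne_head p q hpq
  have h₃ := h.tail_ne_head p q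
  have h₄ := h.tail_ne_head q p
  have hp := p.2
  have hq := q.2
  rw [interlace_iff_of_lt σ p q, interlace_iff_of_lt σ q p]
  simp only [Xor, ne_eq, hpq, not_false_iff, true_and, Nat.cast_inj] at *
  omega

theorem dirAdjMat_cast {m : ℕ} [NeZero m] {σ : ZMod m → ZMod m}
    (hinv : Function.Involutive σ) :
    (dirAdjMat σ).map (Int.castRingHom (ZMod 2)) = adjMat (intersectionGraph σ) := by
  ext p q
  rw [Matrix.map_apply, adjMat, dirAdjMat, intersectionGraph_adj hinv]
  by_cases h : interlace σ p q
  · have hne : p.1.val ≠ q.1.val := fun he => by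
      have := Subtype.ext (ZMod.val_injective m he)
      simp [this, interlace_iff_of_lt, Xor] at h
    simp only [h, if_true]
    split_ifs
    · simp
    · simp
    · omega
  · simp [h]

theorem charpoly_dirAdjMat {m : ℕ} [NeZero m] {σ : ZMod m → ZMod m}
    (hinv : Function.Involutive σ) :
    (dirAdjMat σ).charpoly = skewCharPoly (intersectionGraph σ) := by
  rw [Matrix.charpoly_eq_sum_minors, skewCharPoly]
  refine Finset.sum_congr rfl fun U _ => ?_
  have h := distinctEnds_of_involutive hinv
  set N := (dirAdjMat σ).submatrix (Subtype.val : U → _) Subtype.val with hN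
  have hNc : N = crossingMat (fun p : U => (p.1.1.val : ℤ))
      (fun p : U => ((σ p.1).val : ℤ)) := by
    rw [hN, dirAdjMat_eq_crossingMat hinv]
    ext p q
    simp only [Matrix.submatrix_apply, crossingMat, Subtype.coe_inj]
  have hU : DistinctEnds (fun p : U => (p.1.1.val : ℤ)) (fun p : U => ((σ p.1).val : ℤ)) :=
    ⟨fun k l hkl => h.tail_ne_tail k l (Subtype.coe_injective.ne hkl),
      fun k l hkl => h.head_ne_head k l (Subtype.coe_injective.ne hkl),
      fun k l => h.tail_ne_head k l⟩
  have hskew : (-1) ^ U.card * N.det = N.det := by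
    have hT : N.transpose = -N := by
      rw [hNc]
      ext p q
      rcases eq_or_ne p q with rfl | hpq
      · simp [crossingMat]
      · simp [-ZMod.natCast_val, crossingMat, hpq, hpq.symm, hU.crossing_swap hpq]
    simpa [Matrix.det_neg, hT] using (Matrix.det_transpose N)
  have hcast : (adjMat ((intersectionGraph σ).induce (U : Set _))).det = (N.det : ZMod 2) := by
    rw [← eq_intCast (Int.castRingHom (ZMod 2)), RingHom.map_det, RingHom.mapMatrix_apply, hN,
      ← Matrix.submatrix_map, dirAdjMat_cast hinv]
    rfl
  rw [hskew, hcast]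
  rcases hU.det_crossingMat rfl with h0 | h1
  · rw [hNc, h0]; simp
  · rw [hNc, h1]; simp

theorem skewCharPoly_congr {V W : Type} [Fintype V] [DecidableEq V] [Fintype W] [DecidableEq W]
    {G : SimpleGraph V} {H : SimpleGraph W} (e : G ≃g H) : skewCharPoly G = skewCharPoly H := by
  rw [skewCharPoly, skewCharPoly]
  refine Fintype.sum_equiv e.toEquiv.finsetCongr _ _ fun U => ?_
  let eU : U ≃ e.toEquiv.finsetCongr U :=
    e.toEquiv.subtypeEquiv fun v => by
      rw [Equiv.finsetCongr_apply, Finset.mem_map_equiv, Equiv.symm_apply_apply]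
  have hdet : (adjMat (G.induce (U : Set V))).det =
      (adjMat (H.induce (e.toEquiv.finsetCongr U : Set W))).det := by
    rw [← Matrix.det_submatrix_equiv_self eU]
    congr 1
    ext i j
    simp only [Matrix.submatrix_apply, adjMat]
    congr 1
    exact propext e.map_adj_iff.symm
  rw [hdet, Fintype.card_congr e.toEquiv, Equiv.finsetCongr_apply, Finset.card_map]

theorem btwn_swap {m : ℕ} [NeZero m] {a c x : ZMod m} (hac : a ≠ c) (hxa : x ≠ a) (hxc : x ≠ c) :
    btwn c a x ↔ ¬ btwn a c x := by
  unfold btwn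
  have hX : x - a ≠ 0 := sub_ne_zero.mpr hxa
  have hC : c - a ≠ 0 := sub_ne_zero.mpr hac.symm
  have hXC : x - a ≠ c - a := fun h => hxc (sub_left_injective h)
  rw [← sub_sub_sub_cancel_right x c a, ← neg_sub c a]
  generalize x - a = X at *
  generalize c - a = C at *
  have hX' : X.val ≠ 0 := (ZMod.val_ne_zero X).mpr hX
  have hC' : C.val ≠ 0 := (ZMod.val_ne_zero C).mpr hC
  have hXC' : X.val ≠ C.val := (ZMod.val_injective m).ne hXC
  have hXm := X.val_lt
  have hCm := C.val_lt
  rw [ZMod.neg_val, if_neg hC]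
  rcases le_or_gt C.val X.val with h | h
  · rw [ZMod.val_sub h]; omega
  · rw [← neg_sub C X, ZMod.neg_val, if_neg (sub_ne_zero.mpr hXC.symm), ZMod.val_sub h.le]
    omega

section Rotation

variable {m : ℕ} {σ : ZMod m → ZMod m}

theorem interlace_apply_right (hinv : Function.Involutive σ) (p q : ZMod m) :
    interlace σ p (σ q) ↔ interlace σ p q := by
  rw [interlace, interlace, hinv q]
  exact iff_of_eq (xor_comm _ _)

theorem interlace_apply_left [NeZero m] (hinv : Function.Involutive σ) (hfree : ∀ i, σ i ≠ i)
    {p q : ZMod m} (hqp : q ≠ p) (hqσ : q ≠ σ p) :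
    interlace σ (σ p) q ↔ interlace σ p q := by
  have hσq : σ q ≠ p := fun h => hqσ (by rw [← h, hinv])
  have hσσ : σ q ≠ σ p := hinv.injective.ne hqp
  rw [interlace, interlace, hinv p, btwn_swap (hfree p).symm hqp hqσ,
    btwn_swap (hfree p).symm hσq hσσ]
  exact xor_not_not

theorem interlace_rotate (p q : ZMod m) :
    interlace (fun i => σ (i - 1) + 1) p q ↔ interlace σ (p - 1) (q - 1) := by
  have h : ∀ a b x : ZMod m, btwn a (b + 1) x ↔ btwn (a - 1) b (x - 1) := fun a b x => by
    unfold btwn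
    rw [sub_sub_sub_cancel_right, show b + 1 - a = b - (a - 1) by ring]
  unfold interlace
  rw [h, h, add_sub_cancel_right]

/-- The smaller endpoint of the chord of `σ` containing `x`. -/
def smallEnd (σ : ZMod m → ZMod m) (x : ZMod m) : ZMod m :=
  if x.val < (σ x).val then x else σ x

theorem smallEnd_eq_or (σ : ZMod m → ZMod m) (x : ZMod m) :
    smallEnd σ x = x ∨ smallEnd σ x = σ x := by
  unfold smallEnd
  split_ifs <;> simp

theorem smallEnd_of_lt {x : ZMod m} (h : x.val < (σ x).val) : smallEnd σ x = x := if_pos h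

theorem smallEnd_lt [NeZero m] (hinv : Function.Involutive σ) (hfree : ∀ i, σ i ≠ i)
    (x : ZMod m) : (smallEnd σ x).val < (σ (smallEnd σ x)).val := by
  have := (ZMod.val_injective m).ne (hfree x)
  unfold smallEnd
  split_ifs with h
  · exact h
  · rw [hinv]; omega

theorem smallEnd_apply [NeZero m] (hinv : Function.Involutive σ) (hfree : ∀ i, σ i ≠ i)
    (x : ZMod m) : smallEnd σ (σ x) = smallEnd σ x := by
  have := (ZMod.val_injective m).ne (hfree x)
  unfold smallEnd
  rw [hinv]
  split_ifs <;> first | rfl | omega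

theorem interlace_smallEnd [NeZero m] (hinv : Function.Involutive σ) (hfree : ∀ i, σ i ≠ i)
    {p q : ZMod m} (hqp : q ≠ p) (hqσ : q ≠ σ p) :
    interlace σ (smallEnd σ p) (smallEnd σ q) ↔ interlace σ p q := by
  have hq : interlace σ (smallEnd σ p) (smallEnd σ q) ↔ interlace σ (smallEnd σ p) q := by
    rcases smallEnd_eq_or σ q with h | h <;> rw [h]
    exact interlace_apply_right hinv _ _
  rw [hq]
  rcases smallEnd_eq_or σ p with h | h <;> rw [h]
  exact interlace_apply_left hinv hfree hqp hqσ

theorem involutive_rotate (hinv : Function.Involutive σ) :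
    Function.Involutive fun i => σ (i - 1) + 1 := fun i => by
  simp [hinv (i - 1)]

theorem rotate_ne (hfree : ∀ i, σ i ≠ i) (i : ZMod m) : σ (i - 1) + 1 ≠ i :=
  fun h => hfree (i - 1) (eq_sub_of_add_eq h)

/-- Rotating a chord diagram does not change its intersection graph. -/
def intersectionGraphRotateIso [NeZero m] (hinv : Function.Involutive σ)
    (hfree : ∀ i, σ i ≠ i) :
    intersectionGraph (fun i => σ (i - 1) + 1) ≃g intersectionGraph σ where
  toFun p := ⟨smallEnd σ (p.1 - 1), smallEnd_lt hinv hfree _⟩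
  invFun p := ⟨smallEnd (fun i => σ (i - 1) + 1) (p.1 + 1),
    smallEnd_lt (involutive_rotate hinv) (rotate_ne hfree) _⟩
  left_inv p := by
    refine Subtype.ext (Eq.trans ?_ (smallEnd_of_lt (σ := fun i => σ (i - 1) + 1) p.2))
    rcases smallEnd_eq_or σ (p.1 - 1) with h | h
    · simp only [h, sub_add_cancel]
    · simp only [h]
      exact smallEnd_apply (involutive_rotate hinv) (rotate_ne hfree) p.1
  right_inv p := by
    refine Subtype.ext (Eq.trans ?_ (smallEnd_of_lt p.2))
    rcases smallEnd_eq_or (fun i => σ (i - 1) + 1) (p.1 + 1) with h | h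
    · simp only [h, add_sub_cancel_right]
    · simp only [h, add_sub_cancel_right]
      exact smallEnd_apply hinv hfree p.1
  map_rel_iff' {p q} := by
    rcases eq_or_ne p q with rfl | hpq
    · simp
    rw [intersectionGraph_adj hinv, intersectionGraph_adj (involutive_rotate hinv),
      interlace_rotate]
    refine interlace_smallEnd hinv hfree (fun h => hpq (Subtype.ext (sub_left_injective h).symm))
      fun h => ?_
    have hq : q.1 = σ (p.1 - 1) + 1 := sub_eq_iff_eq_add.mp h
    have h₁ := q.2
    have h₂ := p.2
    simp only [hq, add_sub_cancel_right, hinv (p.1 - 1), sub_add_cancel] at h₁ h₂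
    exact h₁.not_gt h₂

end Rotation

/-- The characteristic polynomial `det(x·I − M)` of the skew-symmetric adjacency matrix
`M` of the directed intersection graph of a chord diagram equals the skew characteristic
polynomial of its intersection graph; in particular it is unchanged when `σ` is
conjugated by the rotation `i ↦ i + 1` of `ZMod (2n)` (independence of the cut point). -/
theorem charpoly_dirAdjMat_eq_skewCharPoly (n : ℕ) [NeZero n]
    (σ : ZMod (2 * n) → ZMod (2 * n)) (hinv : ∀ i, σ (σ i) = i) (hfree : ∀ i, σ i ≠ i) :
    (dirAdjMat σ).charpoly = skewCharPoly (intersectionGraph σ) ∧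
      (dirAdjMat fun i : ZMod (2 * n) => σ (i - 1) + 1).charpoly = (dirAdjMat σ).charpoly := by
  have h : Function.Involutive σ := hinv
  refine ⟨charpoly_dirAdjMat h, ?_⟩
  rw [charpoly_dirAdjMat h, charpoly_dirAdjMat (involutive_rotate h)]
  exact skewCharPoly_congr (intersectionGraphRotateIso h hfree)
end

section
/- The boundary of a chord diagram is connected if and only if its intersection graph is nondegenerate: let σ be a chord diagram with n ≥ 1 chords on ZMod(2n) and let A be the n×n matrix over F₂ indexed by the chords with A_{ab} = 1 if the chords a and b interlace and A_{ab} = 0 otherwise (in particular the diagonal is zero). Then the permutation τ of ZMod(2n) defined by τ(i) = σ(i+1), whose cycles are the boundary components of the orientable one-vertex ribbon graph associated to σ, has exactly one cycle (acts transitively on ZMod(2n)) if and only if A is invertible over F₂. -/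
open Classical in
/-- The adjacency matrix over `F₂` of the intersection graph of a chord diagram `σ`,
indexed by the chords of `σ` (represented by their smaller endpoints): the `(a,b)` entry
is `1` exactly when the chords `a` and `b` interlace. -/
noncomputable def chordAdjMat {m : ℕ} (σ : ZMod m → ZMod m) :
    Matrix {p : ZMod m // p.val < (σ p).val} {p : ZMod m // p.val < (σ p).val} (ZMod 2) :=
  fun p q => if interlace σ p.1 q.1 then 1 else 0

open Finset in
/-- Summing over all points amounts to summing both endpoints over all chords. -/
theorem sum_eq_sum_chords {m : ℕ} [NeZero m] {M : Type*} [AddCommMonoid M]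
    {σ : ZMod m → ZMod m} (hinv : ∀ i, σ (σ i) = i) (hfree : ∀ i, σ i ≠ i) (F : ZMod m → M) :
    ∑ x, F x = ∑ p : {p : ZMod m // p.val < (σ p).val}, (F p.1 + F (σ p.1)) := by
  rw [← sum_filter_add_sum_filter_not univ (fun x : ZMod m => x.val < (σ x).val) F,
    sum_add_distrib]
  congr 1
  · exact sum_subtype _ (by simp) F
  · rw [← sum_subtype (univ.filter fun x : ZMod m => x.val < (σ x).val) (by simp)
      (fun x => F (σ x))]
    refine sum_nbij' σ σ ?_ ?_ ?_ ?_ ?_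
    · intro x hx
      have hne : (σ x).val ≠ x.val := fun h => hfree x (ZMod.val_injective m h)
      simp only [mem_filter, mem_univ, true_and, hinv] at hx ⊢
      omega
    · intro x hx
      simp only [mem_filter, mem_univ, true_and, hinv] at hx ⊢
      omega
    · intro x _; exact hinv x
    · intro x _; exact hinv x
    · intro x _; rw [hinv]

open Finset in
theorem sum_zmod_eq_sum_range {m : ℕ} [NeZero m] {M : Type*} [AddCommMonoid M]
    (F : ZMod m → M) (a : ZMod m) : ∑ x, F x = ∑ k ∈ range m, F (a + k) := by
  refine sum_bij' (fun x _ => (x - a).val) (fun k _ => a + k) ?_ ?_ ?_ ?_ ?_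
  · intro x _; exact mem_range.2 (ZMod.val_lt _)
  · intro k _; exact mem_univ _
  · intro x _; simp
  · intro k hk; simp [ZMod.val_cast_of_lt (mem_range.1 hk)]
  · intro x _; simp

open Finset Classical in
/-- A discrete derivative sums over the open cyclic interval from `a` to `c` to the difference
of the boundary values. -/
theorem sum_btwn_eq_sub {m : ℕ} [NeZero m] {M : Type*} [AddCommGroup M]
    {w h : ZMod m → M} (hw : ∀ i, w i = h i - h (i - 1)) {a c : ZMod m} (hac : c ≠ a) :
    ∑ x, (if btwn a c x then w x else 0) = h (c - 1) - h a := by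
  obtain ⟨d, hd⟩ : ∃ d, (c - a).val = d + 1 :=
    Nat.exists_eq_succ_of_ne_zero (by rwa [Ne, ZMod.val_eq_zero, sub_eq_zero])
  have hdm : d + 1 < m := hd ▸ ZMod.val_lt (c - a)
  have hc : c - 1 = a + d := by
    have : ((c - a).val : ZMod m) = c - a := ZMod.natCast_rightInverse _
    rw [hd] at this
    push_cast at this
    linear_combination -this
  rw [sum_zmod_eq_sum_range _ a, ← sum_filter, hc]
  have hset : (range m).filter (fun k : ℕ => btwn a c (a + k)) = Ico 1 (d + 1) := by
    ext k
    simp only [mem_filter, mem_range, mem_Ico, btwn, add_sub_cancel_left, hd]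
    constructor
    · rintro ⟨hk, h⟩
      rw [ZMod.val_cast_of_lt hk] at h
      omega
    · intro h
      have hk : k < m := by omega
      rw [ZMod.val_cast_of_lt hk]
      omega
  rw [hset, sum_Ico_eq_sum_range, Nat.add_sub_cancel]
  have hterm : ∀ k : ℕ, w (a + ((1 + k : ℕ) : ZMod m)) =
      h (a + ((k + 1 : ℕ) : ZMod m)) - h (a + (k : ZMod m)) := by
    intro k
    rw [hw]
    congr 2 <;> push_cast <;> ring
  simp only [hterm]
  rw [sum_range_sub (fun k : ℕ => h (a + (k : ZMod m)))]
  simp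

open Finset in
/-- A function with total sum zero on a cyclic group is a discrete derivative. -/
theorem exists_eq_sub_of_sum_eq_zero {m : ℕ} [NeZero m] {M : Type*} [AddCommGroup M]
    {w : ZMod m → M} (hw : ∑ x, w x = 0) : ∃ h : ZMod m → M, ∀ i, w i = h i - h (i - 1) := by
  refine ⟨fun i => ∑ k ∈ range (i.val + 1), w k, fun i => ?_⟩
  obtain ⟨l, rfl⟩ : ∃ l, m = l + 1 := Nat.exists_eq_succ_of_ne_zero (NeZero.ne m)
  by_cases hi : i = 0
  · subst hi
    beta_reduce
    have htot := sum_zmod_eq_sum_range w 0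
    simp only [zero_add, hw] at htot
    rw [zero_sub, ZMod.val_neg_one, ← htot]
    simp
  · have h1 : i.val ≠ 0 := by rwa [Ne, ZMod.val_eq_zero]
    obtain ⟨d, hd⟩ := Nat.exists_eq_succ_of_ne_zero h1
    have hdm : d + 1 < l + 1 := by have := ZMod.val_lt i; omega
    have hcast : i = ((d + 1 : ℕ) : ZMod (l + 1)) := by
      simpa only [hd] using (ZMod.natCast_rightInverse i).symm
    have hpred : (i - 1).val = d := by
      rw [hcast]
      push_cast
      rw [add_sub_cancel_right, ZMod.val_cast_of_lt (by omega)]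
    beta_reduce
    rw [hpred, hd, Nat.succ_eq_add_one, sum_range_succ _ (d + 1), ← hcast, add_sub_cancel_left]

/-- On a `σ`-invariant function that is a discrete derivative of `h`, the adjacency matrix
computes the differences of `h` along the chords. -/
theorem chordAdjMat_mulVec {m : ℕ} [NeZero m] {σ : ZMod m → ZMod m}
    (hinv : ∀ i, σ (σ i) = i) (hfree : ∀ i, σ i ≠ i) {w h : ZMod m → ZMod 2}
    (hwσ : ∀ i, w (σ i) = w i) (hw : ∀ i, w i = h i - h (i - 1))
    (p : {p : ZMod m // p.val < (σ p).val}) :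
    (chordAdjMat σ).mulVec (fun q => w q.1) p = h (σ p.1 - 1) - h p.1 := by
  classical
  rw [← sum_btwn_eq_sub hw (hfree p.1), sum_eq_sum_chords hinv hfree]
  refine Finset.sum_congr rfl fun q _ => ?_
  simp only [chordAdjMat, interlace, hwσ]
  by_cases h1 : btwn p.1 (σ p.1) q.1 <;> by_cases h2 : btwn p.1 (σ p.1) (σ q.1) <;>
    simp [h1, h2, Xor', CharTwo.add_self_eq_zero]

/-- Every vector indexed by the chords comes from a `σ`-invariant function on the points. -/
theorem exists_invariant_extension {m : ℕ} [NeZero m] {M : Type*} {σ : ZMod m → ZMod m}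
    (hinv : ∀ i, σ (σ i) = i) (hfree : ∀ i, σ i ≠ i)
    (v : {p : ZMod m // p.val < (σ p).val} → M) :
    ∃ w : ZMod m → M, (∀ i, w (σ i) = w i) ∧ (fun q => w q.1) = v := by
  have hσ : ∀ x, ¬ x.val < (σ x).val → (σ x).val < (σ (σ x)).val := by
    intro x hx
    have hne : (σ x).val ≠ x.val := fun h => hfree x (ZMod.val_injective m h)
    rw [hinv]
    omega
  refine ⟨fun x => if hx : x.val < (σ x).val then v ⟨x, hx⟩ else v ⟨σ x, hσ x hx⟩, ?_, ?_⟩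
  · intro i
    by_cases hi : i.val < (σ i).val
    · have hi' : ¬ (σ i).val < (σ (σ i)).val := by rw [hinv]; omega
      beta_reduce
      rw [dif_neg hi', dif_pos hi]
      simp only [hinv]
    · simp only [hi, hσ i hi, dite_true, dite_false]
  · funext q
    simp [q.2]

/-- The boundary permutation `i ↦ σ (i + 1)`. -/
def boundaryPerm {m : ℕ} (σ : ZMod m → ZMod m) (hinv : ∀ i, σ (σ i) = i) :
    Equiv.Perm (ZMod m) :=
  (Equiv.addRight 1).trans (Function.Involutive.toPerm σ hinv)

theorem eq_const_of_sub_pred_eq_zero {m : ℕ} [NeZero m] {M : Type*} [AddGroup M]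
    {h : ZMod m → M} (hh : ∀ i, h i - h (i - 1) = 0) (i j : ZMod m) : h i = h j := by
  have key : ∀ k : ℕ, h (i + k) = h i := by
    intro k
    induction k with
    | zero => simp
    | succ k ih =>
      have := sub_eq_zero.1 (hh (i + ((k + 1 : ℕ) : ZMod m)))
      rw [this, ← ih]
      congr 1
      push_cast
      ring
  have := key (j - i).val
  rw [ZMod.natCast_rightInverse (j - i)] at this
  rw [← this, add_sub_cancel]

/-- The kernel of the adjacency matrix is trivial exactly when the functions invariant under the
boundary permutation are constant. -/
theorem isUnit_det_chordAdjMat_iff {m : ℕ} [NeZero m] {σ : ZMod m → ZMod m}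
    (hinv : ∀ i, σ (σ i) = i) (hfree : ∀ i, σ i ≠ i) :
    IsUnit (chordAdjMat σ).det ↔
      ∀ h : ZMod m → ZMod 2, (∀ i, h (σ (i + 1)) = h i) → ∀ i j, h i = h j := by
  rw [isUnit_iff_ne_zero, Ne, ← Matrix.exists_mulVec_eq_zero_iff]
  constructor
  · intro hdet h hτ
    have hτ' : ∀ i, h (σ i) = h (i - 1) := fun i => by simpa using hτ (i - 1)
    have hτ'' : ∀ i, h (σ i - 1) = h i := fun i => by rw [← hτ', hinv]
    have hwσ : ∀ i, h (σ i) - h (σ i - 1) = h i - h (i - 1) := fun i => by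
      rw [hτ'', hτ', CharTwo.sub_eq_add (h _), CharTwo.sub_eq_add (h _), add_comm]
    have hv : (fun q : {p : ZMod m // p.val < (σ p).val} => h q.1 - h (q.1 - 1)) = 0 := by
      by_contra hne
      refine hdet ⟨_, hne, funext fun p => ?_⟩
      rw [chordAdjMat_mulVec hinv hfree (w := fun i => h i - h (i - 1)) hwσ (fun _ => rfl) p,
        hτ'', sub_self, Pi.zero_apply]
    refine eq_const_of_sub_pred_eq_zero fun i => ?_
    by_cases hi : i.val < (σ i).val
    · exact congrFun hv ⟨i, hi⟩
    · have hne : (σ i).val ≠ i.val := fun h => hfree i (ZMod.val_injective m h)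
      rw [← hwσ]
      exact congrFun hv ⟨σ i, by rw [hinv]; omega⟩
  · rintro hconst ⟨v, hv0, hv⟩
    obtain ⟨w, hwσ, rfl⟩ := exists_invariant_extension hinv hfree v
    obtain ⟨h, hw⟩ := exists_eq_sub_of_sum_eq_zero (w := w) (by
      rw [sum_eq_sum_chords hinv hfree]
      exact Finset.sum_eq_zero fun p _ => by rw [hwσ, CharTwo.add_self_eq_zero])
    have hlt : ∀ p : ZMod m, p.val < (σ p).val → h (σ p - 1) = h p := fun p hp => by
      have := congrFun hv ⟨p, hp⟩
      rw [chordAdjMat_mulVec hinv hfree hwσ hw] at this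
      exact sub_eq_zero.1 this
    have hpt : ∀ p, h (σ p) = h (p - 1) := by
      intro p
      by_cases hp : p.val < (σ p).val
      · have h1 := hwσ p
        rw [hw, hw, hlt p hp, CharTwo.sub_eq_add (h _), CharTwo.sub_eq_add (h _), add_comm] at h1
        exact add_left_cancel h1
      · have hne : (σ p).val ≠ p.val := fun h => hfree p (ZMod.val_injective m h)
        have := hlt (σ p) (by rw [hinv]; omega)
        rw [hinv] at this
        exact this.symm
    refine hv0 (funext fun q => ?_)
    rw [hw, hconst h (fun i => by rw [hpt, add_sub_cancel_right]) q.1 (q.1 - 1), sub_self,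
      Pi.zero_apply]

/-- A permutation of a finite type is transitive exactly when its invariant functions are
constant. -/
theorem transitive_iff_invariant_const {α : Type*} [Finite α] {R : Type*} [Nontrivial R]
    (τ : Equiv.Perm α) :
    (∀ i j, ∃ k : ℕ, τ^[k] i = j) ↔
      ∀ h : α → R, (∀ i, h (τ i) = h i) → ∀ i j, h i = h j := by
  classical
  constructor
  · intro htrans h hh i j
    obtain ⟨k, rfl⟩ := htrans i j
    induction k with
    | zero => rfl
    | succ k ih => rw [Function.iterate_succ_apply', hh, ih]
  · intro hconst i j
    obtain ⟨a, b, hab⟩ := exists_pair_ne R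
    have := hconst (fun x => if τ.SameCycle i x then a else b) (fun x => by simp) i j
    have hij : τ.SameCycle i j := by
      by_contra hn
      exact hab (by simpa [hn, Equiv.Perm.SameCycle.refl] using this)
    obtain ⟨k, hk⟩ := hij.exists_nat_pow_eq
    exact ⟨k, by rw [← hk, Equiv.Perm.iterate_eq_pow]⟩

/-- The boundary of a chord diagram is connected iff its intersection graph is
nondegenerate: the permutation `τ : i ↦ σ(i+1)` of `ZMod (2n)`, whose cycles are the
boundary components of the orientable one-vertex ribbon graph of `σ`, has exactly one
cycle (acts transitively) iff the adjacency matrix of the intersection graph of `σ` is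
invertible over `F₂`. -/
theorem boundary_connected_iff_nondegenerate (n : ℕ) [NeZero n]
    (σ : ZMod (2 * n) → ZMod (2 * n)) (hn : 1 ≤ n)
    (hinv : ∀ i, σ (σ i) = i) (hfree : ∀ i, σ i ≠ i) :
    (∀ i j : ZMod (2 * n), ∃ k : ℕ, (fun x : ZMod (2 * n) => σ (x + 1))^[k] i = j) ↔
      IsUnit (chordAdjMat σ).det := by
  rw [isUnit_det_chordAdjMat_iff hinv hfree]
  exact transitive_iff_invariant_const (boundaryPerm σ hinv)
end

section
/- The interlace polynomial of even binary delta-matroids satisfies the 4-term relations: the Vassiliev moves take even binary delta-matroids to even binary delta-matroids (in particular the resulting set systems are proper), and for every even binary delta-matroid D = (E; S) and all distinct a, b ∈ E one has L_D(x) − L_{D′_{ab}}(x) = L_{D̃_{ab}}(x) − L_{D̃′_{ab}}(x) in ℤ[x]. -/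
open Classical in
/-- The collection of admissible sets of the delta-matroid `δ(G)` of a finite simple
graph `G`: a set `U` of vertices is admissible iff the adjacency matrix over `F₂` of the
induced subgraph `G|_U` is invertible. -/
noncomputable def graphAdmissible {V : Type} [Fintype V] [DecidableEq V]
    (G : SimpleGraph V) : Finset (Finset V) :=
  Finset.univ.filter fun U => IsUnit (adjMat (G.induce (↑U : Set V))).det

/-- The twist of a set system by a subset `U` of the ground set. -/
def twistSys {V : Type} [DecidableEq V] (S : Finset (Finset V)) (U : Finset V) :
    Finset (Finset V) :=
  S.image fun X => symmDiff X U

/-- A set system on the ground set `V` is a binary delta-matroid if it is a twist of the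
delta-matroid of some simple graph on `V`. -/
def IsBinarySys {V : Type} [Fintype V] [DecidableEq V] (S : Finset (Finset V)) : Prop :=
  ∃ (G : SimpleGraph V) (U : Finset V), S = twistSys (graphAdmissible G) U

/-- A set system is even if all its members have cardinalities of the same parity. -/
def IsEvenSys {V : Type} (S : Finset (Finset V)) : Prop :=
  ∀ X ∈ S, ∀ Y ∈ S, X.card % 2 = Y.card % 2

open Classical in
/-- Handle sliding (the second Vassiliev move) on set systems:
`D̃_{ab} = (E; S Δ {X ∪ {a} : X ⊆ E∖{a,b}, X ∪ {b} ∈ S})`. -/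
noncomputable def slideSys {V : Type} [Fintype V] [DecidableEq V] (S : Finset (Finset V))
    (a b : V) : Finset (Finset V) :=
  symmDiff S (Finset.univ.filter fun W => a ∈ W ∧ b ∉ W ∧ insert b (W.erase a) ∈ S)

open Classical in
/-- Handle end exchange (the first Vassiliev move) on set systems:
`D′_{ab} = (E; S Δ {X ∪ {a,b} : X ⊆ E∖{a,b}, X ∈ S})`. -/
noncomputable def exchangeSys {V : Type} [Fintype V] [DecidableEq V]
    (S : Finset (Finset V)) (a b : V) : Finset (Finset V) :=
  symmDiff S (Finset.univ.filter fun W => a ∈ W ∧ b ∈ W ∧ (W.erase a).erase b ∈ S)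

/-- The distance `d_D(U) = min_{W ∈ S} |U Δ W|` from a set system to a subset of the
ground set. -/
noncomputable def distSys {V : Type} [DecidableEq V] (S : Finset (Finset V))
    (U : Finset V) : ℕ :=
  sInf ((fun W => (symmDiff U W).card) '' (↑S : Set (Finset V)))

/-- The interlace polynomial `L_D(x) = Σ_{U ⊆ E} x^{d_D(U)}` of a set system. -/
noncomputable def interlacePolySys {V : Type} [Fintype V] [DecidableEq V]
    (S : Finset (Finset V)) : Polynomial ℤ :=
  ∑ U : Finset V, (Polynomial.X : Polynomial ℤ) ^ distSys S U

/-- The symplectic plane over `F₂` attached to an element of the ground set. -/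
abbrev BinPlane : Type := ZMod 2 × ZMod 2

/-- A coordinate of `BinPlane`, selected by a truth value. -/
def transv (s : Bool) : BinPlane →ₗ[ZMod 2] ZMod 2 :=
  bif s then LinearMap.snd _ _ _ else LinearMap.fst _ _ _

/-- The hyperbolic quadratic form on the sum of two copies of `BinPlane`. -/
def pairForm (p : BinPlane × BinPlane) : ZMod 2 := p.1.1 * p.1.2 + p.2.1 * p.2.2

/-- The isometry of a pair of planes underlying handle sliding. -/
def slidePair : (BinPlane × BinPlane) →ₗ[ZMod 2] (BinPlane × BinPlane) where
  toFun p := ((p.1.1, p.1.2 + p.2.2), (p.2.1 + p.1.1, p.2.2))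
  map_add' p q := by ext <;> simp <;> ring
  map_smul' c p := by ext <;> simp <;> ring

/-- The isometry of a pair of planes underlying handle end exchange. -/
def exchangePair : (BinPlane × BinPlane) →ₗ[ZMod 2] (BinPlane × BinPlane) where
  toFun p := ((p.1.1, p.1.2 + p.2.1), (p.2.1, p.2.2 + p.1.1))
  map_add' p q := by ext <;> simp <;> ring
  map_smul' c p := by ext <;> simp <;> ring

/-- Coordinate subspaces of the sum of two copies of `BinPlane`. -/
def pairSub (s t : Bool) : Submodule (ZMod 2) (BinPlane × BinPlane) :=
  (LinearMap.ker (transv s)).prod (LinearMap.ker (transv t))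

theorem mem_pairSub {s t : Bool} {p : BinPlane × BinPlane} :
    p ∈ pairSub s t ↔ (bif s then p.1.2 else p.1.1) = 0 ∧ (bif t then p.2.2 else p.2.1) = 0 := by
  cases s <;> cases t <;> simp [pairSub, transv, Submodule.mem_prod]

instance decidableMemPairSub (s t : Bool) (p : BinPlane × BinPlane) :
    Decidable (p ∈ pairSub s t) :=
  decidable_of_iff' _ mem_pairSub

/-- The four-element span of two vectors over `F₂`, as a truth value. -/
def inSpan (p q r : BinPlane × BinPlane) : Bool :=
  r == 0 || r == p || r == q || r == p + q

/-- The two vectors are independent and span a totally singular plane. -/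
def spansSingular (p q : BinPlane × BinPlane) : Bool :=
  p != 0 && q != 0 && p != q && pairForm p == 0 && pairForm q == 0 && pairForm (p + q) == 0

/-- The span of two vectors, pulled back along `τ`, meets the coordinate subspace trivially. -/
def spanTransverse (τ : (BinPlane × BinPlane) → (BinPlane × BinPlane))
    (p q : BinPlane × BinPlane) (s t : Bool) : Prop :=
  ∀ r, inSpan p q (τ r) → r ∈ pairSub s t → r = 0

instance decidableSpanTransverse (τ : (BinPlane × BinPlane) → (BinPlane × BinPlane))
    (p q : BinPlane × BinPlane) (s t : Bool) : Decidable (spanTransverse τ p q s t) :=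
  inferInstanceAs (Decidable (∀ r, inSpan p q (τ r) → r ∈ pairSub s t → r = 0))

theorem inSpan_of_singular : ∀ p q r : BinPlane × BinPlane, spansSingular p q →
    pairForm r = 0 → pairForm (p + r) = 0 → pairForm (q + r) = 0 → inSpan p q r := by
  decide +kernel

set_option synthInstance.maxHeartbeats 400000 in
set_option synthInstance.maxSize 1000 in
theorem slide_or_exchange_fixes : ∀ p q : BinPlane × BinPlane, spansSingular p q →
    (∀ r, inSpan p q r = inSpan p q (slidePair r)) ∨
    ((∀ r, inSpan p q r = inSpan p q (exchangePair r)) ∧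
     (∀ r, inSpan p q (slidePair r) = inSpan p q (slidePair (exchangePair r)))) := by
  decide +kernel

theorem spanTransverse_exchange : ∀ p q : BinPlane × BinPlane, spansSingular p q → ∀ s t,
    (spanTransverse exchangePair p q s t ↔
      Xor (spanTransverse id p q s t) (s ∧ t ∧ spanTransverse id p q false false)) := by
  unfold Xor
  decide +kernel

theorem spanTransverse_slide : ∀ p q : BinPlane × BinPlane, spansSingular p q → ∀ s t,
    (spanTransverse slidePair p q s t ↔
      Xor (spanTransverse id p q s t) (s ∧ ¬ t ∧ spanTransverse id p q false true)) := by
  unfold Xor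
  decide +kernel

set_option linter.unusedSectionVars false

section
variable {V : Type} [Fintype V] [DecidableEq V]

/-- The standard quadratic form on the sum of the symplectic planes over the ground set. -/
def hypForm (z : V → BinPlane) : ZMod 2 := ∑ v, (z v).1 * (z v).2

/-- The polarization of `hypForm`. -/
def sympForm : (V → BinPlane) →ₗ[ZMod 2] (V → BinPlane) →ₗ[ZMod 2] ZMod 2 :=
  LinearMap.mk₂ (ZMod 2) (fun z w => ∑ v, ((z v).1 * (w v).2 + (z v).2 * (w v).1))
    (fun x y z => by
      rw [← Finset.sum_add_distrib]
      exact Finset.sum_congr rfl fun v _ => by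
        simp only [Pi.add_apply, Prod.fst_add, Prod.snd_add]; ring)
    (fun c x y => by
      rw [Finset.smul_sum]
      exact Finset.sum_congr rfl fun v _ => by
        simp only [Pi.smul_apply, Prod.smul_fst, Prod.smul_snd, smul_eq_mul]; ring)
    (fun x y z => by
      rw [← Finset.sum_add_distrib]
      exact Finset.sum_congr rfl fun v _ => by
        simp only [Pi.add_apply, Prod.fst_add, Prod.snd_add]; ring)
    (fun c x y => by
      rw [Finset.smul_sum]
      exact Finset.sum_congr rfl fun v _ => by
        simp only [Pi.smul_apply, Prod.smul_fst, Prod.smul_snd, smul_eq_mul]; ring)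

theorem sympForm_apply (z w : V → BinPlane) :
    sympForm z w = ∑ v, ((z v).1 * (w v).2 + (z v).2 * (w v).1) := rfl

theorem hypForm_add (z w : V → BinPlane) :
    hypForm (z + w) = hypForm z + hypForm w + sympForm z w := by
  rw [sympForm_apply]
  simp only [hypForm, ← Finset.sum_add_distrib]
  exact Finset.sum_congr rfl fun v _ => by
    simp only [Pi.add_apply, Prod.fst_add, Prod.snd_add]; ring

/-- A totally singular subspace of maximal dimension. -/
structure IsMaxSingular (L : Submodule (ZMod 2) (V → BinPlane)) : Prop where
  hypForm_eq_zero : ∀ z ∈ L, hypForm z = 0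
  card_le : Fintype.card V ≤ Module.finrank (ZMod 2) L

theorem IsMaxSingular.sympForm_eq_zero {L : Submodule (ZMod 2) (V → BinPlane)}
    (hL : IsMaxSingular L) {z w : V → BinPlane} (hz : z ∈ L) (hw : w ∈ L) :
    sympForm z w = 0 := by
  have h := hypForm_add z w
  rwa [hL.1 _ (L.add_mem hz hw), hL.1 _ hz, hL.1 _ hw, zero_add, zero_add, eq_comm] at h

theorem IsMaxSingular.comap {L : Submodule (ZMod 2) (V → BinPlane)} (hL : IsMaxSingular L)
    {f : (V → BinPlane) →ₗ[ZMod 2] (V → BinPlane)} (hf : Function.Involutive f)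
    (hq : ∀ z, hypForm (f z) = hypForm z) : IsMaxSingular (L.comap f) where
  hypForm_eq_zero z hz := by rw [← hq]; exact hL.1 _ hz
  card_le := by
    refine hL.2.trans ?_
    have h : L.comap f = L.map f := by
      ext z
      exact ⟨fun h => ⟨f z, h, hf z⟩, by rintro ⟨w, hw, rfl⟩; simpa [hf w] using hw⟩
    rw [h]
    exact (LinearEquiv.finrank_eq (Submodule.equivMapOfInjective f hf.injective L)).le

/-- The coordinate maximal singular subspace indexed by a subset of the ground set. -/
def coordSub (U : Finset V) : Submodule (ZMod 2) (V → BinPlane) where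
  carrier := {z | ∀ v, transv (decide (v ∈ U)) (z v) = 0}
  add_mem' hz hw v := by simp [hz v, hw v]
  zero_mem' v := by simp
  smul_mem' c z hz v := by simp [hz v]

theorem mem_coordSub {U : Finset V} {z : V → BinPlane} :
    z ∈ coordSub U ↔ ∀ v, transv (decide (v ∈ U)) (z v) = 0 := Iff.rfl

/-- The corank of a subset of the ground set with respect to a subspace. -/
noncomputable def corank (L : Submodule (ZMod 2) (V → BinPlane)) (U : Finset V) : ℕ :=
  Module.finrank (ZMod 2) ↥(L ⊓ coordSub U)

open Classical in
/-- The set system of a subspace: its members index the transverse coordinate subspaces. -/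
noncomputable def feasible (L : Submodule (ZMod 2) (V → BinPlane)) : Finset (Finset V) :=
  Finset.univ.filter fun U => L ⊓ coordSub U = ⊥

theorem mem_feasible {L : Submodule (ZMod 2) (V → BinPlane)} {U : Finset V} :
    U ∈ feasible L ↔ L ⊓ coordSub U = ⊥ := by
  simp [feasible]

theorem mem_feasible_iff_corank {L : Submodule (ZMod 2) (V → BinPlane)} {U : Finset V} :
    U ∈ feasible L ↔ corank L U = 0 := by
  rw [mem_feasible, corank, Submodule.finrank_eq_zero]

/-- On a coordinate line of `BinPlane`, the sum of coordinates is injective. -/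
theorem eq_zero_of_transv {s : Bool} {p : BinPlane} (h : transv s p = 0) (h' : p.1 + p.2 = 0) :
    p = 0 := by
  obtain ⟨x, y⟩ := p
  cases s <;> simp_all [transv]

/-- The sums of the two coordinates over the elements of a finite type mapped to `V`. -/
def coordSum {ι : Type} (i : ι → V) : (V → BinPlane) →ₗ[ZMod 2] (ι → ZMod 2) where
  toFun z j := (z (i j)).1 + (z (i j)).2
  map_add' z w := by ext; simp only [Pi.add_apply, Prod.fst_add, Prod.snd_add]; ring
  map_smul' c z := by ext; simp [mul_add]

theorem finrank_le_card_of_coordSum {ι : Type} [Fintype ι] (i : ι → V)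
    (N : Submodule (ZMod 2) (V → BinPlane)) (h : ∀ z ∈ N, coordSum i z = 0 → z = 0) :
    Module.finrank (ZMod 2) N ≤ Fintype.card ι := by
  have hinj : Function.Injective ((coordSum i).domRestrict N) := by
    rw [← LinearMap.ker_eq_bot, LinearMap.ker_eq_bot']
    exact fun z hz => Subtype.ext (h z z.2 hz)
  simpa using LinearMap.finrank_le_finrank_of_injective hinj

theorem corank_le_card_symmDiff {L : Submodule (ZMod 2) (V → BinPlane)} {U W : Finset V}
    (hW : W ∈ feasible L) : corank L U ≤ (symmDiff U W).card := by
  rw [← Fintype.card_coe]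
  refine finrank_le_card_of_coordSum (fun j : ↥(symmDiff U W) => (j : V)) _ fun z hz h0 => ?_
  rw [mem_feasible] at hW
  have : z ∈ L ⊓ coordSub W := by
    refine ⟨hz.1, fun v => ?_⟩
    by_cases hv : v ∈ symmDiff U W
    · rw [eq_zero_of_transv (hz.2 v) (congrFun h0 ⟨v, hv⟩), map_zero]
    · have hUW : v ∈ U ↔ v ∈ W := by
        rw [Finset.mem_symmDiff] at hv; tauto
      simpa only [hUW] using hz.2 v
  rwa [hW] at this

theorem IsMaxSingular.inf_coordSub_lt {L : Submodule (ZMod 2) (V → BinPlane)}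
    (hL : IsMaxSingular L) {U : Finset V} {z : V → BinPlane} (hz : z ∈ L ⊓ coordSub U) {v : V}
    (hv : z v ≠ 0) : L ⊓ coordSub (symmDiff U {v}) < L ⊓ coordSub U := by
  have key : ∀ w ∈ L ⊓ coordSub (symmDiff U {v}), w v = 0 := by
    intro w hw
    have h := hL.sympForm_eq_zero hz.1 hw.1
    rw [sympForm_apply, Finset.sum_eq_single v] at h
    · have h1 := hz.2 v
      have h2 := hw.2 v
      rcases hp : z v with ⟨x, y⟩
      rcases hq : w v with ⟨x', y'⟩
      rw [hp] at h h1 hv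
      rw [hq] at h h2
      by_cases hU : v ∈ U <;> simp [hU, transv, Finset.mem_symmDiff] at h1 h2 <;>
        simp_all
    · intro u _ hu
      have h1 := hz.2 u
      have h2 := hw.2 u
      by_cases hU : u ∈ U <;> simp [hU, hu, transv, Finset.mem_symmDiff] at h1 h2 <;>
        simp [h1, h2]
    · simp
  refine lt_of_le_of_ne (fun w hw => ⟨hw.1, fun u => ?_⟩) fun h => hv (key z (h ▸ hz))
  by_cases hu : u = v
  · rw [hu, key w hw, map_zero]
  · simpa [Finset.mem_symmDiff, hu] using hw.2 u

theorem IsMaxSingular.exists_feasible {L : Submodule (ZMod 2) (V → BinPlane)}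
    (hL : IsMaxSingular L) (n : ℕ) (U : Finset V) (hn : corank L U ≤ n) :
    ∃ W ∈ feasible L, (symmDiff U W).card ≤ n := by
  induction n generalizing U with
  | zero => exact ⟨U, mem_feasible_iff_corank.2 (Nat.le_zero.1 hn), by simp⟩
  | succ n ih =>
    by_cases h : L ⊓ coordSub U = ⊥
    · exact ⟨U, mem_feasible.2 h, by simp⟩
    obtain ⟨z, hz, h0⟩ := Submodule.exists_mem_ne_zero_of_ne_bot h
    obtain ⟨v, hv⟩ := Function.ne_iff.1 h0
    have hlt := Submodule.finrank_lt_finrank_of_lt (hL.inf_coordSub_lt hz hv)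
    obtain ⟨W, hW, hc⟩ := ih (symmDiff U {v}) (by unfold corank at hn ⊢; omega)
    refine ⟨W, hW, ?_⟩
    have h1 : symmDiff U W ⊆ insert v (symmDiff (symmDiff U {v}) W) := by
      intro u; simp only [Finset.mem_insert, Finset.mem_symmDiff, Finset.mem_singleton]; tauto
    exact (Finset.card_le_card h1).trans ((Finset.card_insert_le _ _).trans (by omega))

theorem IsMaxSingular.distSys_feasible {L : Submodule (ZMod 2) (V → BinPlane)}
    (hL : IsMaxSingular L) (U : Finset V) : distSys (feasible L) U = corank L U := by
  obtain ⟨W, hW, hc⟩ := hL.exists_feasible _ U le_rfl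
  refine le_antisymm ((Nat.sInf_le (Set.mem_image_of_mem _ (Finset.mem_coe.2 hW))).trans hc)
    (le_csInf ⟨_, W, hW, rfl⟩ ?_)
  rintro _ ⟨W', hW', rfl⟩
  exact corank_le_card_symmDiff hW'

/-- Exchange of the two coordinates of the planes over a subset of the ground set. -/
def swapOn (T : Finset V) : (V → BinPlane) →ₗ[ZMod 2] (V → BinPlane) where
  toFun z v := if v ∈ T then (z v).swap else z v
  map_add' z w := by ext v <;> by_cases hv : v ∈ T <;> simp [hv]
  map_smul' c z := by ext v <;> by_cases hv : v ∈ T <;> simp [hv]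

theorem swapOn_apply (T : Finset V) (z : V → BinPlane) (v : V) :
    swapOn T z v = if v ∈ T then (z v).swap else z v := rfl

theorem swapOn_involutive (T : Finset V) : Function.Involutive (swapOn T) := by
  intro z
  ext v <;> by_cases hv : v ∈ T <;> simp [swapOn_apply, hv]

theorem hypForm_swapOn (T : Finset V) (z : V → BinPlane) :
    hypForm (swapOn T z) = hypForm z := by
  refine Finset.sum_congr rfl fun v _ => ?_
  by_cases hv : v ∈ T <;> simp [swapOn_apply, hv, mul_comm]

theorem swapOn_mem_coordSub {T U : Finset V} {z : V → BinPlane} :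
    swapOn T z ∈ coordSub U ↔ z ∈ coordSub (symmDiff U T) := by
  simp only [mem_coordSub]
  refine forall_congr' fun v => ?_
  by_cases hv : v ∈ T <;> by_cases hu : v ∈ U <;>
    simp [swapOn_apply, hv, hu, Finset.mem_symmDiff, transv]

theorem comap_inf_eq_bot {f : (V → BinPlane) →ₗ[ZMod 2] (V → BinPlane)}
    (hf : Function.Involutive f) {L N N' : Submodule (ZMod 2) (V → BinPlane)}
    (h : ∀ z, f z ∈ N ↔ z ∈ N') : L.comap f ⊓ N = ⊥ ↔ L ⊓ N' = ⊥ := by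
  simp only [Submodule.eq_bot_iff, Submodule.mem_inf, Submodule.mem_comap]
  constructor
  · intro H z hz
    have := H (f z) ⟨by simpa [hf z] using hz.1, (h z).2 hz.2⟩
    rw [← hf z, this, map_zero]
  · intro H z hz
    have := H (f z) ⟨hz.1, (h _).1 (by simpa [hf z] using hz.2)⟩
    rw [← hf z, this, map_zero]

theorem feasible_comap_swapOn (L : Submodule (ZMod 2) (V → BinPlane)) (T : Finset V) :
    feasible (L.comap (swapOn T)) = twistSys (feasible L) T := by
  ext U
  have h : U ∈ twistSys (feasible L) T ↔ symmDiff U T ∈ feasible L := by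
    simp only [twistSys, Finset.mem_image]
    constructor
    · rintro ⟨X, hX, rfl⟩
      simpa using hX
    · exact fun h => ⟨_, h, by simp⟩
  rw [h, mem_feasible, mem_feasible]
  exact comap_inf_eq_bot (swapOn_involutive T) fun z => swapOn_mem_coordSub

/-- The graph of the adjacency matrix of a simple graph, as a subspace. -/
noncomputable def graphSub (G : SimpleGraph V) : Submodule (ZMod 2) (V → BinPlane) where
  carrier := {z | (fun v => (z v).2) = (adjMat G).mulVec fun v => (z v).1}
  add_mem' {z w} hz hw := by
    have := congrArg₂ (· + ·) hz hw
    simp only [← Matrix.mulVec_add] at this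
    exact this
  zero_mem' := by
    have : (fun _ : V => (0 : ZMod 2)) = 0 := rfl
    simp [this]
  smul_mem' c z hz := by
    have := congrArg (c • ·) hz
    simp only [← Matrix.mulVec_smul] at this
    exact this

theorem mem_graphSub {G : SimpleGraph V} {z : V → BinPlane} :
    z ∈ graphSub G ↔ ∀ v, (z v).2 = ∑ w, adjMat G v w * (z w).1 :=
  funext_iff

theorem adjMat_symm (G : SimpleGraph V) (v w : V) : adjMat G v w = adjMat G w v := by
  by_cases h : G.Adj v w
  · simp [adjMat, h, h.symm]
  · have h' : ¬ G.Adj w v := fun h' => h h'.symm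
    simp [adjMat, h, h']

theorem isMaxSingular_graphSub (G : SimpleGraph V) : IsMaxSingular (graphSub G) where
  hypForm_eq_zero z hz := by
    rw [mem_graphSub] at hz
    have h : hypForm z = ∑ p : V × V, (z p.1).1 * (adjMat G p.1 p.2 * (z p.2).1) := by
      simp only [hypForm, hz, Finset.mul_sum, Fintype.sum_prod_type]
    rw [h]
    refine Finset.sum_involution (fun p _ => p.swap) ?_ ?_ (by simp) (by simp)
    · intro p _
      rw [Prod.fst_swap, Prod.snd_swap, adjMat_symm G p.2 p.1]
      convert CharTwo.add_self_eq_zero ((z p.1).1 * (adjMat G p.1 p.2 * (z p.2).1)) using 2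
      ring
    · rintro ⟨v, w⟩ _ hne heq
      obtain rfl : w = v := congrArg Prod.fst heq
      simp [adjMat] at hne
  card_le := by
    let f : (V → ZMod 2) →ₗ[ZMod 2] (V → BinPlane) :=
      { toFun := fun x v => (x v, (adjMat G).mulVec x v)
        map_add' := fun x y => by ext <;> simp [Matrix.mulVec_add]
        map_smul' := fun c x => by ext <;> simp [Matrix.mulVec_smul] }
    have hf : ∀ x, f x ∈ graphSub G := fun x => mem_graphSub.2 fun v => rfl
    have hinj : Function.Injective (f.codRestrict _ hf) := fun x y h => by
      funext v
      exact congrArg (fun z : graphSub G => ((z : V → BinPlane) v).1) h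
    simpa using LinearMap.finrank_le_finrank_of_injective hinj

theorem mem_graphAdmissible {G : SimpleGraph V} {U : Finset V} :
    U ∈ graphAdmissible G ↔ ∀ x : V → ZMod 2, (∀ v ∉ U, x v = 0) →
      (∀ v ∈ U, ∑ w, adjMat G v w * x w = 0) → x = 0 := by
  have hsum : ∀ (x : V → ZMod 2), (∀ v ∉ U, x v = 0) → ∀ v : (U : Set V),
      (adjMat (G.induce (U : Set V))).mulVec (fun w => x w) v = ∑ w, adjMat G v w * x w := by
    intro x hx v
    rw [← Finset.sum_subset (Finset.subset_univ U) fun w _ hw => by rw [hx w hw, mul_zero],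
      ← Finset.sum_coe_sort U]
    rfl
  simp only [graphAdmissible, Finset.mem_filter, Finset.mem_univ, true_and, isUnit_iff_ne_zero]
  rw [Ne, ← Matrix.exists_mulVec_eq_zero_iff]
  constructor
  · intro h x hx h0
    by_contra hne
    refine h ⟨fun v => x v, fun h' => hne ?_, funext fun v => ?_⟩
    · funext v
      by_cases hv : v ∈ U
      · exact congrFun h' ⟨v, hv⟩
      · exact hx v hv
    · rw [hsum x hx v]
      exact h0 v v.2
  · rintro h ⟨y, hy, h0⟩
    have hx : ∀ v ∉ U, (fun v => if h : v ∈ U then y ⟨v, h⟩ else 0) v = 0 := fun v hv => by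
      simp [hv]
    have hy' : (fun w : (U : Set V) => (fun v => if h : v ∈ U then y ⟨v, h⟩ else 0) (w : V)) = y := by
      funext w
      exact dif_pos w.2
    refine hy ?_
    rw [← hy', h _ hx fun v hv => ?_]
    · rfl
    · rw [← hsum _ hx ⟨v, hv⟩, hy', h0]
      rfl

theorem feasible_graphSub (G : SimpleGraph V) : feasible (graphSub G) = graphAdmissible G := by
  ext U
  rw [mem_feasible, mem_graphAdmissible, Submodule.eq_bot_iff]
  simp only [Submodule.mem_inf, mem_graphSub, mem_coordSub]
  constructor
  · intro h x hx h0
    have := h (fun v => (x v, ∑ w, adjMat G v w * x w)) ⟨fun v => rfl, fun v => ?_⟩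
    · funext v
      exact congrArg Prod.fst (congrFun this v)
    · by_cases hv : v ∈ U
      · simpa [hv, transv] using h0 v hv
      · simpa [hv, transv] using hx v hv
  · rintro h z ⟨hz, hc⟩
    have hx := h (fun v => (z v).1) (fun v hv => by simpa [hv, transv] using hc v)
      (fun v hv => by rw [← hz v]; simpa [hv, transv] using hc v)
    funext v
    refine Prod.ext (congrFun hx v) ?_
    rw [hz v]
    exact Finset.sum_eq_zero fun w _ => by rw [show (z w).1 = 0 from congrFun hx w, mul_zero]

theorem IsMaxSingular.exists_eq_graphSub {L : Submodule (ZMod 2) (V → BinPlane)}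
    (hL : IsMaxSingular L) (h : ∅ ∈ feasible L) :
    ∃ G : SimpleGraph V, feasible L = graphAdmissible G := by
  rw [mem_feasible, Submodule.eq_bot_iff] at h
  let p : L →ₗ[ZMod 2] (V → ZMod 2) :=
    { toFun := fun z v => ((z : V → BinPlane) v).1
      map_add' := fun z w => rfl
      map_smul' := fun c z => rfl }
  have hinj : Function.Injective p := by
    rw [← LinearMap.ker_eq_bot, LinearMap.ker_eq_bot']
    intro z hz
    exact Subtype.ext (h z ⟨z.2, fun v => congrFun hz v⟩)
  have hrank : Module.finrank (ZMod 2) L = Module.finrank (ZMod 2) (V → ZMod 2) :=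
    le_antisymm (LinearMap.finrank_le_finrank_of_injective hinj) (by simpa using hL.2)
  have hsurj := (LinearMap.injective_iff_surjective_of_finrank_eq_finrank hrank).1 hinj
  choose e he using fun v => hsurj (Pi.single v 1)
  have hfst : ∀ v w, ((e v : V → BinPlane) w).1 = if w = v then 1 else 0 := fun v w => by
    rw [show ((e v : V → BinPlane) w).1 = p (e v) w from rfl, he, Pi.single_apply]
  have hdiag : ∀ v, ((e v : V → BinPlane) v).2 = 0 := fun v => by
    simpa [hypForm, hfst] using hL.1 _ (e v).2
  have hsymm : ∀ v w, ((e v : V → BinPlane) w).2 = ((e w : V → BinPlane) v).2 := fun v w => by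
    have := hL.sympForm_eq_zero (e w).2 (e v).2
    simpa [sympForm_apply, hfst, Finset.sum_add_distrib, CharTwo.add_eq_zero] using this
  let G : SimpleGraph V :=
    { Adj := fun v w => ((e v : V → BinPlane) w).2 = 1
      symm := ⟨fun v w hvw => by rwa [hsymm] at hvw⟩
      loopless := ⟨fun v hv => by simp [hdiag] at hv⟩ }
  have hadj : ∀ v w, adjMat G v w = ((e w : V → BinPlane) v).2 := fun v w => by
    rw [hsymm]
    have h01 : ∀ c : ZMod 2, c = 0 ∨ c = 1 := by decide
    rcases h01 ((e v : V → BinPlane) w).2 with h0 | h1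
    · rw [h0]
      exact if_neg fun hvw : ((e v : V → BinPlane) w).2 = 1 => by simp [h0] at hvw
    · rw [h1]
      exact if_pos h1
  refine ⟨G, ?_⟩
  rw [← feasible_graphSub]
  congr 1
  have hle : L ≤ graphSub G := by
    intro z hz
    rw [mem_graphSub]
    have hz' : (⟨z, hz⟩ : L) = ∑ w, (z w).1 • e w := by
      apply hinj
      simp only [map_sum, map_smul, he]
      exact pi_eq_sum_univ' _
    intro v
    have := congrArg (fun y : L => ((y : V → BinPlane) v).2) hz'
    simp only [Submodule.coe_sum, Finset.sum_apply, Prod.snd_sum] at this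
    rw [this]
    exact Finset.sum_congr rfl fun w _ => by rw [hadj, mul_comm]; rfl
  refine Submodule.eq_of_le_of_finrank_le hle ?_
  rw [hrank, Module.finrank_fintype_fun_eq_card]
  refine (LinearMap.finrank_le_finrank_of_injective
    (f := (LinearMap.pi fun v => (LinearMap.fst _ _ _).comp (LinearMap.proj v) :
      (V → BinPlane) →ₗ[ZMod 2] (V → ZMod 2)).domRestrict (graphSub G)) ?_).trans (by simp)
  rw [← LinearMap.ker_eq_bot, LinearMap.ker_eq_bot']
  intro z hz
  have h0 : ∀ v, ((z : V → BinPlane) v).1 = 0 := fun v => congrFun hz v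
  refine Subtype.ext (funext fun v => Prod.ext (h0 v) ?_)
  rw [mem_graphSub.1 z.2 v]
  simp [h0]

theorem isBinarySys_iff {S : Finset (Finset V)} :
    IsBinarySys S ↔ ∃ L : Submodule (ZMod 2) (V → BinPlane), IsMaxSingular L ∧ feasible L = S := by
  constructor
  · rintro ⟨G, T, rfl⟩
    exact ⟨_, (isMaxSingular_graphSub G).comap (swapOn_involutive T) (hypForm_swapOn T),
      by rw [feasible_comap_swapOn, feasible_graphSub]⟩
  · rintro ⟨L, hL, rfl⟩
    obtain ⟨T, hT, -⟩ := hL.exists_feasible _ ∅ le_rfl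
    obtain ⟨G, hG⟩ := (hL.comap (swapOn_involutive T) (hypForm_swapOn T)).exists_eq_graphSub (by
      rw [feasible_comap_swapOn]
      exact Finset.mem_image.2 ⟨T, hT, symmDiff_self T⟩)
    refine ⟨G, T, ?_⟩
    rw [← hG, feasible_comap_swapOn, twistSys, twistSys, Finset.image_image]
    simp [Function.comp_def]

theorem IsBinarySys.nonempty {S : Finset (Finset V)} (h : IsBinarySys S) : S.Nonempty := by
  obtain ⟨L, hL, rfl⟩ := isBinarySys_iff.1 h
  obtain ⟨T, hT, -⟩ := hL.exists_feasible _ ∅ le_rfl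
  exact ⟨T, hT⟩

/-- Vectors whose components outside a pair of elements lie on the coordinate lines. -/
def awaySub (a b : V) (U : Finset V) : Submodule (ZMod 2) (V → BinPlane) where
  carrier := {z | ∀ v, v ≠ a → v ≠ b → transv (decide (v ∈ U)) (z v) = 0}
  add_mem' hz hw v ha hb := by simp [hz v ha hb, hw v ha hb]
  zero_mem' v := by simp
  smul_mem' c z hz v ha hb := by simp [hz v ha hb]

/-- The components at a pair of elements. -/
def pairProj (a b : V) : (V → BinPlane) →ₗ[ZMod 2] BinPlane × BinPlane :=
  (LinearMap.proj a).prod (LinearMap.proj b)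

theorem pairProj_apply (a b : V) (z : V → BinPlane) : pairProj a b z = (z a, z b) := rfl

theorem coordSub_eq (a b : V) (U : Finset V) : coordSub U =
    awaySub a b U ⊓ (pairSub (decide (a ∈ U)) (decide (b ∈ U))).comap (pairProj a b) := by
  ext z
  constructor
  · exact fun h => ⟨fun v _ _ => h v, h a, h b⟩
  · rintro ⟨h, ha, hb⟩ v
    by_cases hva : v = a
    · exact hva ▸ ha
    by_cases hvb : v = b
    · exact hvb ▸ hb
    exact h v hva hvb

/-- The reduction of a subspace to a pair of elements. -/
def pairReduct (L : Submodule (ZMod 2) (V → BinPlane)) (a b : V) (U : Finset V) :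
    Submodule (ZMod 2) (BinPlane × BinPlane) :=
  (L ⊓ awaySub a b U).map (pairProj a b)

/-- The kernel of the reduction of a subspace to a pair of elements. -/
def pairCore (L : Submodule (ZMod 2) (V → BinPlane)) (a b : V) (U : Finset V) :
    Submodule (ZMod 2) (V → BinPlane) :=
  L ⊓ awaySub a b U ⊓ LinearMap.ker (pairProj a b)

theorem finrank_inf_comap {K M M' : Type*} [Field K] [AddCommGroup M] [Module K M]
    [FiniteDimensional K M] [AddCommGroup M'] [Module K M'] (f : M →ₗ[K] M')
    (N : Submodule K M) (D : Submodule K M') :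
    Module.finrank K ↥(N ⊓ D.comap f) =
      Module.finrank K ↥(N ⊓ LinearMap.ker f) + Module.finrank K ↥(N.map f ⊓ D) := by
  have hker : (LinearMap.ker (f.domRestrict (N ⊓ D.comap f))).map (Submodule.subtype _) =
      N ⊓ LinearMap.ker f := by
    ext x
    simp only [Submodule.mem_map, Submodule.mem_inf]
    constructor
    · rintro ⟨z, hz, rfl⟩
      exact ⟨z.2.1, hz⟩
    · rintro ⟨hx, hk⟩
      exact ⟨⟨x, hx, by rw [SetLike.mem_coe, Submodule.mem_comap, hk]; exact D.zero_mem⟩, hk, rfl⟩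
  have hrange : LinearMap.range (f.domRestrict (N ⊓ D.comap f)) = N.map f ⊓ D := by
    ext x
    simp only [LinearMap.mem_range, Submodule.mem_inf, Submodule.mem_map]
    constructor
    · rintro ⟨⟨z, hz⟩, rfl⟩
      exact ⟨⟨z, hz.1, rfl⟩, hz.2⟩
    · rintro ⟨⟨z, hz, rfl⟩, hx⟩
      exact ⟨⟨z, hz, hx⟩, rfl⟩
  rw [← LinearMap.finrank_range_add_finrank_ker (f.domRestrict (N ⊓ D.comap f)), hrange,
    ← Submodule.finrank_map_subtype_eq _ (LinearMap.ker _), hker, add_comm]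

theorem corank_eq (L : Submodule (ZMod 2) (V → BinPlane)) (a b : V) (U : Finset V) :
    corank L U = Module.finrank (ZMod 2) (pairCore L a b U) +
      Module.finrank (ZMod 2)
        ↥(pairReduct L a b U ⊓ pairSub (decide (a ∈ U)) (decide (b ∈ U))) := by
  rw [corank, coordSub_eq a b, ← inf_assoc, finrank_inf_comap]
  rfl

theorem awaySub_congr {a b : V} {U W : Finset V}
    (h : ∀ v, v ≠ a → v ≠ b → (v ∈ U ↔ v ∈ W)) : awaySub a b U = awaySub a b W := by
  ext z
  exact forall_congr' fun v => forall_congr' fun ha => forall_congr' fun hb => by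
    simp only [h v ha hb]

theorem hypForm_eq_pairForm {a b : V} (hab : a ≠ b) {U : Finset V} {z : V → BinPlane}
    (hz : z ∈ awaySub a b U) : hypForm z = pairForm (pairProj a b z) := by
  rw [hypForm, ← Finset.sum_subset (Finset.subset_univ {a, b}), Finset.sum_pair hab]
  · rfl
  · intro v _ hv
    simp only [Finset.mem_insert, Finset.mem_singleton, not_or] at hv
    have := hz v hv.1 hv.2
    by_cases hU : v ∈ U <;> simp [hU, transv] at this <;> simp [this]

theorem IsMaxSingular.pairForm_eq_zero {L : Submodule (ZMod 2) (V → BinPlane)}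
    (hL : IsMaxSingular L) {a b : V} (hab : a ≠ b) {U : Finset V} {r : BinPlane × BinPlane}
    (hr : r ∈ pairReduct L a b U) : pairForm r = 0 := by
  obtain ⟨z, hz, rfl⟩ := hr
  rw [← hypForm_eq_pairForm hab hz.2]
  exact hL.1 z hz.1

theorem sympForm_single (z : V → BinPlane) (v : V) (p : BinPlane) :
    sympForm z (Pi.single v p) = (z v).1 * p.2 + (z v).2 * p.1 := by
  rw [sympForm_apply, Finset.sum_eq_single v]
  · simp
  · intro u _ hu
    simp [hu]
  · simp

theorem IsMaxSingular.two_le_finrank_pairReduct {L : Submodule (ZMod 2) (V → BinPlane)}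
    (hL : IsMaxSingular L) {a b : V} (hab : a ≠ b) (U : Finset V) :
    2 ≤ Module.finrank (ZMod 2) (pairReduct L a b U) := by
  set Q := awaySub a b U ⊓ LinearMap.ker (pairProj a b) with hQ
  have hQcard : Module.finrank (ZMod 2) Q + 2 ≤ Fintype.card V := by
    have h1 : Module.finrank (ZMod 2) Q ≤ Fintype.card ↥(({a, b} : Finset V)ᶜ) := by
      refine finrank_le_card_of_coordSum (fun j : ↥(({a, b} : Finset V)ᶜ) => (j : V)) _
        fun z hz h0 => ?_
      have hk : (z a, z b) = (0, 0) := hz.2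
      rw [Prod.mk.injEq] at hk
      funext v
      by_cases hva : v = a
      · rw [hva, hk.1]; rfl
      by_cases hvb : v = b
      · rw [hvb, hk.2]; rfl
      exact eq_zero_of_transv (hz.1 v hva hvb) (congrFun h0 ⟨v, by simp [hva, hvb]⟩)
    have h2 := Finset.card_compl_add_card ({a, b} : Finset V)
    rw [Finset.card_pair hab] at h2
    rw [Fintype.card_coe] at h1
    omega
  let φ : L →ₗ[ZMod 2] Module.Dual (ZMod 2) Q :=
    (LinearMap.lcomp (ZMod 2) (ZMod 2) Q.subtype).comp (sympForm.comp L.subtype)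
  have hφ : ∀ (z : L) (q : Q), φ z q = sympForm (z : V → BinPlane) q := fun _ _ => rfl
  have hrange : LinearMap.range φ ≤ (L.comap Q.subtype).dualAnnihilator := by
    rintro _ ⟨z, rfl⟩
    rw [Submodule.mem_dualAnnihilator]
    exact fun q hq => hL.sympForm_eq_zero z.2 hq
  have hker : (LinearMap.ker φ).map L.subtype ≤ L ⊓ awaySub a b U := by
    rintro _ ⟨z, hz, rfl⟩
    refine ⟨z.2, fun v hva hvb => ?_⟩
    have hs : Pi.single v (if v ∈ U then (1, 0) else (0, 1)) ∈ Q := by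
      refine ⟨fun u _ _ => ?_, ?_⟩
      · by_cases huv : u = v
        · subst huv
          by_cases hu : u ∈ U <;> simp [hu, transv]
        · simp [huv]
      · simp [pairProj_apply, Ne.symm hva, Ne.symm hvb]
    have h := LinearMap.congr_fun hz ⟨_, hs⟩
    rw [hφ, sympForm_single] at h
    by_cases hv : v ∈ U <;> simpa [hv, transv] using h
  have e1 := LinearMap.finrank_range_add_finrank_ker φ
  have e2 := Submodule.finrank_mono hrange
  have e3 := Subspace.finrank_add_finrank_dualAnnihilator_eq (L.comap Q.subtype)
  have e4 := Submodule.finrank_mono hker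
  rw [Submodule.finrank_map_subtype_eq] at e4
  have e5 := finrank_inf_comap (pairProj a b) (L ⊓ awaySub a b U) ⊤
  rw [Submodule.comap_top, inf_top_eq, inf_top_eq, inf_assoc, ← hQ] at e5
  have e6 : Module.finrank (ZMod 2) (L.comap Q.subtype) = Module.finrank (ZMod 2) ↥(L ⊓ Q) := by
    rw [← Submodule.finrank_map_subtype_eq, Submodule.map_comap_subtype, inf_comm]
  have e7 := hL.2
  unfold pairReduct
  omega

theorem IsMaxSingular.exists_inSpan {L : Submodule (ZMod 2) (V → BinPlane)}
    (hL : IsMaxSingular L) {a b : V} (hab : a ≠ b) (U : Finset V) :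
    ∃ p q, spansSingular p q ∧ ∀ r, r ∈ pairReduct L a b U ↔ inSpan p q r := by
  set R := pairReduct L a b U
  have h2 : 2 ≤ Module.finrank (ZMod 2) R := hL.two_le_finrank_pairReduct hab U
  have h0 : ∀ r ∈ R, pairForm r = 0 := fun r hr => hL.pairForm_eq_zero hab hr
  have hex : ∀ p : R, ∃ q : R, q ≠ 0 ∧ q ≠ p := by
    intro p
    by_contra! h
    have := finrank_le_one (R := ZMod 2) p fun w => by
      by_cases hw : w = 0
      · exact ⟨0, by simp [hw]⟩
      · exact ⟨1, by rw [one_smul, h w hw]⟩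
    omega
  obtain ⟨p, hp, -⟩ := hex 0
  obtain ⟨q, hq, hpq⟩ := hex p
  have hs : spansSingular (p : BinPlane × BinPlane) q := by
    have hp' : (p : BinPlane × BinPlane) ≠ 0 := fun h => hp (Subtype.ext h)
    have hq' : (q : BinPlane × BinPlane) ≠ 0 := fun h => hq (Subtype.ext h)
    have hpq' : (p : BinPlane × BinPlane) ≠ q := fun h => hpq (Subtype.ext h).symm
    simp only [spansSingular, Bool.and_eq_true, bne_iff_ne, beq_iff_eq]
    exact ⟨⟨⟨⟨⟨hp', hq'⟩, hpq'⟩, h0 _ p.2⟩, h0 _ q.2⟩, h0 _ (R.add_mem p.2 q.2)⟩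
  refine ⟨p, q, hs, fun r => ⟨fun hr => inSpan_of_singular p q r hs (h0 r hr)
    (h0 _ (R.add_mem p.2 hr)) (h0 _ (R.add_mem q.2 hr)), fun hr => ?_⟩⟩
  simp only [inSpan, Bool.or_eq_true, beq_iff_eq] at hr
  rcases hr with ((rfl | rfl) | rfl) | rfl
  · exact R.zero_mem
  · exact p.2
  · exact q.2
  · exact R.add_mem p.2 q.2

/-- A linear map of a pair of planes, extended by the identity to the other planes. -/
def extendPair (a b : V) (τ : (BinPlane × BinPlane) →ₗ[ZMod 2] (BinPlane × BinPlane)) :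
    (V → BinPlane) →ₗ[ZMod 2] (V → BinPlane) where
  toFun z v := if v = a then (τ (pairProj a b z)).1 else
    if v = b then (τ (pairProj a b z)).2 else z v
  map_add' z w := by
    funext v
    simp only [map_add, Pi.add_apply]
    split_ifs <;> rfl
  map_smul' c z := by
    funext v
    simp only [map_smul, Pi.smul_apply]
    split_ifs <;> rfl

section
variable {a b : V} {τ : (BinPlane × BinPlane) →ₗ[ZMod 2] (BinPlane × BinPlane)}

theorem extendPair_of_ne {z : V → BinPlane} {v : V} (ha : v ≠ a) (hb : v ≠ b) :
    extendPair a b τ z v = z v := by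
  simp [extendPair, ha, hb]

theorem pairProj_extendPair (hab : a ≠ b) (z : V → BinPlane) :
    pairProj a b (extendPair a b τ z) = τ (pairProj a b z) := by
  simp [extendPair, pairProj_apply, hab.symm]

theorem ext_pairProj {z w : V → BinPlane} (h : pairProj a b z = pairProj a b w)
    (h' : ∀ v, v ≠ a → v ≠ b → z v = w v) : z = w := by
  rw [pairProj_apply, pairProj_apply, Prod.mk.injEq] at h
  funext v
  by_cases ha : v = a
  · rw [ha, h.1]
  by_cases hb : v = b
  · rw [hb, h.2]
  exact h' v ha hb

theorem extendPair_involutive (hab : a ≠ b) (hτ : Function.Involutive τ) :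
    Function.Involutive (extendPair a b τ) := fun z =>
  ext_pairProj (by rw [pairProj_extendPair hab, pairProj_extendPair hab, hτ])
    fun v ha hb => by rw [extendPair_of_ne ha hb, extendPair_of_ne ha hb]

theorem hypForm_extendPair (hab : a ≠ b) (hq : ∀ r, pairForm (τ r) = pairForm r)
    (z : V → BinPlane) : hypForm (extendPair a b τ z) = hypForm z := by
  have h : ∀ w : V → BinPlane, hypForm w =
      pairForm (pairProj a b w) + ∑ v ∈ ({a, b} : Finset V)ᶜ, (w v).1 * (w v).2 := by
    intro w
    rw [hypForm, ← Finset.sum_add_sum_compl {a, b}, Finset.sum_pair hab]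
    rfl
  rw [h, h z, pairProj_extendPair hab, hq]
  congr 1
  refine Finset.sum_congr rfl fun v hv => ?_
  simp only [Finset.mem_compl, Finset.mem_insert, Finset.mem_singleton, not_or] at hv
  rw [extendPair_of_ne hv.1 hv.2]

theorem extendPair_mem_awaySub {U : Finset V} {z : V → BinPlane} :
    extendPair a b τ z ∈ awaySub a b U ↔ z ∈ awaySub a b U :=
  forall_congr' fun v => forall_congr' fun ha => forall_congr' fun hb => by
    rw [extendPair_of_ne ha hb]

theorem pairCore_comap_extendPair (hab : a ≠ b) (L : Submodule (ZMod 2) (V → BinPlane))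
    (U : Finset V) : pairCore (L.comap (extendPair a b τ)) a b U = pairCore L a b U := by
  have h : ∀ z ∈ LinearMap.ker (pairProj a b), extendPair a b τ z = z := fun z hz =>
    ext_pairProj (by rw [pairProj_extendPair hab, hz, map_zero]) fun v => extendPair_of_ne
  ext z
  constructor
  · rintro ⟨⟨hz, hz'⟩, hk⟩
    rw [SetLike.mem_coe, Submodule.mem_comap, h z hk] at hz
    exact ⟨⟨hz, hz'⟩, hk⟩
  · rintro ⟨⟨hz, hz'⟩, hk⟩
    refine ⟨⟨?_, hz'⟩, hk⟩
    rwa [SetLike.mem_coe, Submodule.mem_comap, h z hk]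

theorem mem_pairReduct_comap_extendPair (hab : a ≠ b) (hτ : Function.Involutive τ)
    {L : Submodule (ZMod 2) (V → BinPlane)} {U : Finset V} {r : BinPlane × BinPlane} :
    r ∈ pairReduct (L.comap (extendPair a b τ)) a b U ↔ τ r ∈ pairReduct L a b U := by
  constructor
  · rintro ⟨z, ⟨hz, hz'⟩, rfl⟩
    exact ⟨extendPair a b τ z, ⟨hz, extendPair_mem_awaySub.2 hz'⟩, pairProj_extendPair hab z⟩
  · rintro ⟨z, ⟨hz, hz'⟩, hr⟩
    refine ⟨extendPair a b τ z, ⟨?_, extendPair_mem_awaySub.2 hz'⟩, ?_⟩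
    · rwa [SetLike.mem_coe, Submodule.mem_comap, extendPair_involutive hab hτ z]
    · rw [pairProj_extendPair hab, hr, hτ r]

theorem mem_feasible_comap_extendPair (hab : a ≠ b) (hτ : Function.Involutive τ)
    {L : Submodule (ZMod 2) (V → BinPlane)} {U W : Finset V} {p q : BinPlane × BinPlane}
    (hpq : ∀ r, r ∈ pairReduct L a b U ↔ inSpan p q r)
    (hW : ∀ v, v ≠ a → v ≠ b → (v ∈ U ↔ v ∈ W)) :
    W ∈ feasible (L.comap (extendPair a b τ)) ↔
      pairCore L a b U = ⊥ ∧ spanTransverse τ p q (decide (a ∈ W)) (decide (b ∈ W)) := by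
  have hA := awaySub_congr hW
  have hC : pairCore L a b W = pairCore L a b U := by rw [pairCore, pairCore, hA]
  have hR : pairReduct L a b W = pairReduct L a b U := by rw [pairReduct, pairReduct, hA]
  rw [mem_feasible_iff_corank, corank_eq _ a b, Nat.add_eq_zero_iff, Submodule.finrank_eq_zero,
    Submodule.finrank_eq_zero, pairCore_comap_extendPair hab, hC, Submodule.eq_bot_iff (_ ⊓ _)]
  refine and_congr_right fun _ => forall_congr' fun r => ?_
  rw [Submodule.mem_inf, mem_pairReduct_comap_extendPair hab hτ, hR, hpq, and_imp]

end

theorem slidePair_involutive : Function.Involutive slidePair := by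
  unfold Function.Involutive; decide

theorem exchangePair_involutive : Function.Involutive exchangePair := by
  unfold Function.Involutive; decide

theorem pairForm_slidePair : ∀ r, pairForm (slidePair r) = pairForm r := by decide

theorem pairForm_exchangePair : ∀ r, pairForm (exchangePair r) = pairForm r := by decide

theorem mem_feasible_iff_spanTransverse {a b : V} (hab : a ≠ b)
    {L : Submodule (ZMod 2) (V → BinPlane)} {U W : Finset V} {p q : BinPlane × BinPlane}
    (hpq : ∀ r, r ∈ pairReduct L a b U ↔ inSpan p q r)
    (hW : ∀ v, v ≠ a → v ≠ b → (v ∈ U ↔ v ∈ W)) :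
    W ∈ feasible L ↔
      pairCore L a b U = ⊥ ∧ spanTransverse id p q (decide (a ∈ W)) (decide (b ∈ W)) := by
  have h : extendPair a b LinearMap.id = LinearMap.id :=
    LinearMap.ext fun z => ext_pairProj (a := a) (b := b)
      (by rw [pairProj_extendPair hab]; rfl) fun _ => extendPair_of_ne
  have := mem_feasible_comap_extendPair hab (τ := LinearMap.id) (fun _ => rfl) hpq hW
  rwa [h, Submodule.comap_id, LinearMap.id_coe] at this

theorem IsMaxSingular.feasible_slide {L : Submodule (ZMod 2) (V → BinPlane)}
    (hL : IsMaxSingular L) {a b : V} (hab : a ≠ b) :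
    feasible (L.comap (extendPair a b slidePair)) = slideSys (feasible L) a b := by
  ext U
  obtain ⟨p, q, hs, hpq⟩ := hL.exists_inSpan hab U
  have h := spanTransverse_slide p q hs (decide (a ∈ U)) (decide (b ∈ U))
  have h1 := mem_feasible_comap_extendPair hab slidePair_involutive hpq
    (W := U) fun _ _ _ => Iff.rfl
  have h2 := mem_feasible_iff_spanTransverse hab hpq (W := U) fun _ _ _ => Iff.rfl
  have h3 := mem_feasible_iff_spanTransverse hab hpq (W := insert b (U.erase a))
    fun v ha hb => by simp [ha, hb]
  rw [decide_eq_false (by simp [hab]), decide_eq_true (Finset.mem_insert_self _ _)] at h3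
  simp only [decide_eq_true_eq] at h
  simp only [slideSys, Finset.mem_symmDiff, Finset.mem_filter, Finset.mem_univ, true_and]
  rw [h1, h, h2, h3, Xor]
  clear h h1 h2 h3 hs hpq
  generalize spanTransverse id p q (decide (a ∈ U)) (decide (b ∈ U)) = A
  generalize spanTransverse id p q false true = B
  generalize (pairCore L a b U = ⊥) = C
  tauto

theorem IsMaxSingular.feasible_exchange {L : Submodule (ZMod 2) (V → BinPlane)}
    (hL : IsMaxSingular L) {a b : V} (hab : a ≠ b) :
    feasible (L.comap (extendPair a b exchangePair)) = exchangeSys (feasible L) a b := by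
  ext U
  obtain ⟨p, q, hs, hpq⟩ := hL.exists_inSpan hab U
  have h := spanTransverse_exchange p q hs (decide (a ∈ U)) (decide (b ∈ U))
  have h1 := mem_feasible_comap_extendPair hab exchangePair_involutive hpq
    (W := U) fun _ _ _ => Iff.rfl
  have h2 := mem_feasible_iff_spanTransverse hab hpq (W := U) fun _ _ _ => Iff.rfl
  have h3 := mem_feasible_iff_spanTransverse hab hpq (W := (U.erase a).erase b)
    fun v ha hb => by simp [ha, hb]
  rw [decide_eq_false (by simp), decide_eq_false (Finset.notMem_erase _ _)] at h3
  simp only [decide_eq_true_eq] at h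
  simp only [exchangeSys, Finset.mem_symmDiff, Finset.mem_filter, Finset.mem_univ, true_and]
  rw [h1, h, h2, h3, Xor]
  clear h h1 h2 h3 hs hpq
  generalize spanTransverse id p q (decide (a ∈ U)) (decide (b ∈ U)) = A
  generalize spanTransverse id p q false false = B
  generalize (pairCore L a b U = ⊥) = C
  tauto

theorem IsMaxSingular.corank_four_term {L : Submodule (ZMod 2) (V → BinPlane)}
    (hL : IsMaxSingular L) {a b : V} (hab : a ≠ b) (U : Finset V) :
    (corank (L.comap (extendPair a b slidePair)) U = corank L U ∧
      corank ((L.comap (extendPair a b slidePair)).comap (extendPair a b exchangePair)) U =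
        corank (L.comap (extendPair a b exchangePair)) U) ∨
    (corank (L.comap (extendPair a b exchangePair)) U = corank L U ∧
      corank ((L.comap (extendPair a b slidePair)).comap (extendPair a b exchangePair)) U =
        corank (L.comap (extendPair a b slidePair)) U) := by
  obtain ⟨p, q, hs, hpq⟩ := hL.exists_inSpan hab U
  simp only [corank_eq _ a b]
  rcases slide_or_exchange_fixes p q hs with h | ⟨h, h'⟩
  · have h1 : pairReduct (L.comap (extendPair a b slidePair)) a b U = pairReduct L a b U := by
      ext r
      rw [mem_pairReduct_comap_extendPair hab slidePair_involutive, hpq, hpq, h r]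
    have h2 : pairReduct ((L.comap (extendPair a b slidePair)).comap (extendPair a b exchangePair))
        a b U = pairReduct (L.comap (extendPair a b exchangePair)) a b U := by
      ext r
      rw [mem_pairReduct_comap_extendPair hab exchangePair_involutive, h1,
        mem_pairReduct_comap_extendPair hab exchangePair_involutive]
    rw [h1, h2]
    exact Or.inl ⟨by rw [pairCore_comap_extendPair hab],
      by rw [pairCore_comap_extendPair hab (L.comap _), pairCore_comap_extendPair hab L,
        pairCore_comap_extendPair hab L]⟩
  · have h1 : pairReduct (L.comap (extendPair a b exchangePair)) a b U = pairReduct L a b U := by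
      ext r
      rw [mem_pairReduct_comap_extendPair hab exchangePair_involutive, hpq, hpq, h r]
    have h2 : pairReduct ((L.comap (extendPair a b slidePair)).comap (extendPair a b exchangePair))
        a b U = pairReduct (L.comap (extendPair a b slidePair)) a b U := by
      ext r
      rw [mem_pairReduct_comap_extendPair hab exchangePair_involutive,
        mem_pairReduct_comap_extendPair hab slidePair_involutive,
        mem_pairReduct_comap_extendPair hab slidePair_involutive, hpq, hpq, h' r]
    rw [h1, h2]
    exact Or.inr ⟨by rw [pairCore_comap_extendPair hab],
      by rw [pairCore_comap_extendPair hab (L.comap _), pairCore_comap_extendPair hab L]⟩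

end

theorem IsEvenSys.slideSys {V : Type} [Fintype V] [DecidableEq V] {S : Finset (Finset V)}
    (hE : IsEvenSys S) (a b : V) : IsEvenSys (slideSys S a b) := by
  have key : ∀ X ∈ _root_.slideSys S a b, ∃ Y ∈ S, X.card % 2 = Y.card % 2 := by
    intro X hX
    simp only [_root_.slideSys, Finset.mem_symmDiff, Finset.mem_filter, Finset.mem_univ,
      true_and] at hX
    rcases hX with h | ⟨⟨ha, hb, h⟩, -⟩
    · exact ⟨X, h.1, rfl⟩
    · refine ⟨_, h, ?_⟩
      rw [Finset.card_insert_of_notMem (fun h' => hb (Finset.mem_of_mem_erase h')),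
        Finset.card_erase_add_one ha]
  intro X hX Y hY
  obtain ⟨X', hX', hX⟩ := key X hX
  obtain ⟨Y', hY', hY⟩ := key Y hY
  rw [hX, hY, hE X' hX' Y' hY']

theorem IsEvenSys.exchangeSys {V : Type} [Fintype V] [DecidableEq V] {S : Finset (Finset V)}
    (hE : IsEvenSys S) {a b : V} (hab : a ≠ b) : IsEvenSys (exchangeSys S a b) := by
  have key : ∀ X ∈ _root_.exchangeSys S a b, ∃ Y ∈ S, X.card % 2 = Y.card % 2 := by
    intro X hX
    simp only [_root_.exchangeSys, Finset.mem_symmDiff, Finset.mem_filter, Finset.mem_univ,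
      true_and] at hX
    rcases hX with h | ⟨⟨ha, hb, h⟩, -⟩
    · exact ⟨X, h.1, rfl⟩
    · refine ⟨_, h, ?_⟩
      have h1 := Finset.card_erase_add_one (Finset.mem_erase.2 ⟨hab.symm, hb⟩)
      have h2 := Finset.card_erase_add_one ha
      omega
  intro X hX Y hY
  obtain ⟨X', hX', hX⟩ := key X hX
  obtain ⟨Y', hY', hY⟩ := key Y hY
  rw [hX, hY, hE X' hX' Y' hY']

/-- The interlace polynomial of even binary delta-matroids satisfies the 4-term
relations: the Vassiliev moves take even binary delta-matroids to even binary
delta-matroids (in particular the resulting set systems are proper), and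
`L_D − L_{D′_{ab}} = L_{D̃_{ab}} − L_{D̃′_{ab}}`. -/
theorem interlacePoly_four_term {V : Type} [Fintype V] [DecidableEq V]
    (S : Finset (Finset V)) (hB : IsBinarySys S) (hE : IsEvenSys S)
    (a b : V) (hab : a ≠ b) :
    (IsBinarySys (slideSys S a b) ∧ IsEvenSys (slideSys S a b) ∧
        (slideSys S a b).Nonempty) ∧
      (IsBinarySys (exchangeSys S a b) ∧ IsEvenSys (exchangeSys S a b) ∧
        (exchangeSys S a b).Nonempty) ∧
      (IsBinarySys (exchangeSys (slideSys S a b) a b) ∧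
        IsEvenSys (exchangeSys (slideSys S a b) a b) ∧
        (exchangeSys (slideSys S a b) a b).Nonempty) ∧
      interlacePolySys S - interlacePolySys (exchangeSys S a b)
        = interlacePolySys (slideSys S a b)
          - interlacePolySys (exchangeSys (slideSys S a b) a b) := by
  obtain ⟨L, hL, rfl⟩ := isBinarySys_iff.1 hB
  have hsl := hL.comap (extendPair_involutive hab slidePair_involutive)
    (hypForm_extendPair hab pairForm_slidePair)
  have hex := hL.comap (extendPair_involutive hab exchangePair_involutive)
    (hypForm_extendPair hab pairForm_exchangePair)
  have hse := hsl.comap (extendPair_involutive hab exchangePair_involutive)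
    (hypForm_extendPair hab pairForm_exchangePair)
  have hBsl := isBinarySys_iff.2 ⟨_, hsl, hL.feasible_slide hab⟩
  have hBex := isBinarySys_iff.2 ⟨_, hex, hL.feasible_exchange hab⟩
  have hBse := isBinarySys_iff.2 ⟨_, hse, hsl.feasible_exchange hab⟩
  rw [hL.feasible_slide hab] at hBse
  refine ⟨⟨hBsl, hE.slideSys a b, hBsl.nonempty⟩, ⟨hBex, hE.exchangeSys hab, hBex.nonempty⟩,
    ⟨hBse, (hE.slideSys a b).exchangeSys hab, hBse.nonempty⟩, ?_⟩
  rw [← hL.feasible_slide hab, ← hsl.feasible_exchange hab, ← hL.feasible_exchange hab]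
  simp only [interlacePolySys, ← Finset.sum_sub_distrib]
  refine Finset.sum_congr rfl fun U _ => ?_
  rw [hL.distSys_feasible, hsl.distSys_feasible, hex.distSys_feasible, hse.distSys_feasible]
  rcases hL.corank_four_term hab U with ⟨h1, h2⟩ | ⟨h1, h2⟩
  · rw [h1, h2]
  · rw [h1, h2, sub_self, sub_self]
end
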